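/- arXiv:0912.3894 — 2 statements merged into one kernel-verified Lean document; each statement's English description precedes it below -/
import Mathlib

section
/- There exists a ∈ (0, π/(2√2)) with 2a = π·cos(a√2). For such a, let Δ = Δ_sq(a), Λ = 4aℤ × 4aℤ × 2πℤ, σ₀(x,y,z) = (−x,−y,z+π), and let Γ be the group generated by the translations by Λ and by σ₀ (so ℝ³/Γ is the Bieberbach manifold C₂ with the singular metric g_c). Then the systole of (C₂, g_c) equals 4a, and with V := 4π · ∫_{[−a,a]²} cos(‖p‖) dp, the Riemannian volume of (C₂, g_c), one has (4a)³ > (2/√3) · V; i.e. the systolic ratio of (C₂, g_c) is strictly greater than 2/√3 (it is approximately 1.18). -/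
open Real MeasureTheory Set

noncomputable section

/-- The point `(x, y)` of the Euclidean plane. -/
def pt2 (x y : ℝ) : EuclideanSpace ℝ (Fin 2) := (WithLp.equiv 2 (Fin 2 → ℝ)).symm ![x, y]

/-- `f : [0,1] → ℝ` is piecewise `C¹`. -/
def PC1 (f : ℝ → ℝ) : Prop :=
  ∃ (n : ℕ) (t : ℕ → ℝ), t 0 = 0 ∧ t n = 1 ∧ (∀ i < n, t i < t (i + 1)) ∧
    ContinuousOn f (Set.Icc 0 1) ∧ ∀ i < n, ContDiffOn ℝ 1 f (Set.Icc (t i) (t (i + 1)))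

/-- Length of `γ = (γ₁,γ₂,γ₃)` for the singular metric
`h = dx² + dy² + cos²(dist((x,y),Δ)) dz²`. -/
def sLen (Δ : Set (EuclideanSpace ℝ (Fin 2))) (γ₁ γ₂ γ₃ : ℝ → ℝ) : ℝ :=
  ∫ t in (0:ℝ)..1, Real.sqrt ((deriv γ₁ t) ^ 2 + (deriv γ₂ t) ^ 2 +
    Real.cos (Metric.infDist (pt2 (γ₁ t) (γ₂ t)) Δ) ^ 2 * (deriv γ₃ t) ^ 2)

/-- The square lattice `Δ_sq(a) = 2aℤ × 2aℤ ⊂ ℝ²`. -/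
def ΔsqE (a : ℝ) : Set (EuclideanSpace ℝ (Fin 2)) :=
  {p | ∃ m n : ℤ, p = pt2 (2 * a * m) (2 * a * n)}

/-- The spatial lattice `Λ = 4aℤ × 4aℤ × 2πℤ ⊂ ℝ³`. -/
def Λsq3 (a : ℝ) : Set (ℝ × ℝ × ℝ) :=
  {w | ∃ k₁ k₂ k₃ : ℤ, w = (4 * a * k₁, 4 * a * k₂, 2 * π * k₃)}

/-- The square `[−a,a]² ⊂ ℝ²` (Voronoi cell of `0` for `Δ_sq(a)`). -/
def sqCell (a : ℝ) : Set (EuclideanSpace ℝ (Fin 2)) :=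
  {p | p 0 ∈ Set.Icc (-a) a ∧ p 1 ∈ Set.Icc (-a) a}

/-- The screw motion `σ₀(x,y,z) = (−x, −y, z + π)`, as a bijection of `ℝ³`. -/
def sigma0Perm : Equiv.Perm (ℝ × ℝ × ℝ) where
  toFun p := (-p.1, -p.2.1, p.2.2 + π)
  invFun p := (-p.1, -p.2.1, p.2.2 - π)
  left_inv := by rintro ⟨x, y, z⟩; simp
  right_inv := by rintro ⟨x, y, z⟩; simp

/-- The group `Γ` generated by the translations by `Λ = 4aℤ × 4aℤ × 2πℤ` and by `σ₀`;
`ℝ³/Γ` is the Bieberbach manifold `C₂` with the singular metric `g_c`. -/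
def Γsq (a : ℝ) : Subgroup (Equiv.Perm (ℝ × ℝ × ℝ)) :=
  Subgroup.closure ((fun w => Equiv.addLeft w) '' Λsq3 a ∪ {sigma0Perm})

theorem exists_mem_Ico_of_mem_Ico (t : ℕ → ℝ) (n : ℕ) {x : ℝ} (hx : x ∈ Ico (t 0) (t n)) :
    ∃ i < n, x ∈ Ico (t i) (t (i + 1)) := by
  induction n with
  | zero => exact absurd hx (by simp)
  | succ n ih =>
    rcases lt_or_ge x (t n) with h | h
    · obtain ⟨i, hi, hxi⟩ := ih ⟨hx.1, h⟩
      exact ⟨i, by omega, hxi⟩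
    · exact ⟨n, by omega, h, hx.2⟩

theorem hasDerivWithinAt_Ici_of_mem_Ico {f : ℝ → ℝ} {a b x : ℝ} (hx : x ∈ Ico a b)
    (hf : DifferentiableWithinAt ℝ f (Icc a b) x) :
    HasDerivWithinAt f (derivWithin f (Icc a b) x) (Ici x) x := by
  have h1 : HasDerivWithinAt f (derivWithin f (Icc a b) x) (Icc x b) x :=
    hf.hasDerivWithinAt.mono (Icc_subset_Icc_left hx.1)
  exact h1.mono_of_mem_nhdsWithin (Icc_mem_nhdsGE hx.2)

theorem PC1.continuousOn {f : ℝ → ℝ} (hf : PC1 f) : ContinuousOn f (Icc 0 1) := by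
  obtain ⟨n, t, -, -, -, h, -⟩ := hf
  exact h

theorem PC1.hasDerivWithinAt {f : ℝ → ℝ} (hf : PC1 f) {x : ℝ} (hx : x ∈ Ico (0 : ℝ) 1) :
    HasDerivWithinAt f (derivWithin f (Ici x) x) (Ici x) x := by
  obtain ⟨n, t, h0, h1, hlt, -, hC⟩ := hf
  obtain ⟨i, hi, hxi⟩ := exists_mem_Ico_of_mem_Ico t n (x := x) (by rwa [h0, h1])
  exact (hasDerivWithinAt_Ici_of_mem_Ico hxi ((hC i hi).differentiableOn one_ne_zero x
    (Ico_subset_Icc_self hxi))).differentiableWithinAt.hasDerivWithinAt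

theorem PC1.exists_abs_derivWithin_le {f : ℝ → ℝ} (hf : PC1 f) :
    ∃ C, ∀ x ∈ Ico (0 : ℝ) 1, |derivWithin f (Ici x) x| ≤ C := by
  obtain ⟨n, t, h0, h1, hlt, -, hC⟩ := hf
  have key : ∀ i, ∃ C, 0 ≤ C ∧ (i < n → ∀ x ∈ Ico (t i) (t (i + 1)),
      |derivWithin f (Ici x) x| ≤ C) := by
    intro i
    by_cases hi : i < n
    · have hc := (hC i hi).continuousOn_derivWithin (uniqueDiffOn_Icc (hlt i hi)) le_rfl
      obtain ⟨C, hCb⟩ := isCompact_Icc.exists_bound_of_continuousOn hc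
      refine ⟨max C 0, le_max_right _ _, fun _ x hx => ?_⟩
      rw [(hasDerivWithinAt_Ici_of_mem_Ico hx ((hC i hi).differentiableOn one_ne_zero x
        (Ico_subset_Icc_self hx))).derivWithin (uniqueDiffWithinAt_Ici x)]
      exact (hCb x (Ico_subset_Icc_self hx)).trans (le_max_left _ _)
    · exact ⟨0, le_rfl, fun h => absurd h hi⟩
  choose C hC0 hCb using key
  refine ⟨∑ i ∈ Finset.range n, C i, fun x hx => ?_⟩
  obtain ⟨i, hi, hxi⟩ := exists_mem_Ico_of_mem_Ico t n (x := x) (by rwa [h0, h1])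
  exact (hCb i hi x hxi).trans
    (Finset.single_le_sum (f := C) (fun j _ => hC0 j) (Finset.mem_range.2 hi))

theorem PC1.ae_deriv_eq {f : ℝ → ℝ} (hf : PC1 f) :
    ∀ᵐ x, x ∈ Ico (0 : ℝ) 1 → deriv f x = derivWithin f (Ici x) x := by
  obtain ⟨n, t, h0, h1, hlt, -, hC⟩ := hf
  have hfin : ((Finset.range n).image t : Set ℝ).Finite := Finset.finite_toSet _
  filter_upwards [hfin.countable.ae_notMem volume] with x hxn hx
  obtain ⟨i, hi, hxi⟩ := exists_mem_Ico_of_mem_Ico t n (x := x) (by rwa [h0, h1])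
  have hne : t i ≠ x := fun h => hxn (by
    simp only [Finset.coe_image, Finset.coe_range, mem_image, mem_Iio]
    exact ⟨i, hi, h⟩)
  have hd := ((hC i hi).differentiableOn one_ne_zero x (Ico_subset_Icc_self hxi)).differentiableAt
    (Icc_mem_nhds (lt_of_le_of_ne hxi.1 hne) hxi.2)
  exact (hd.derivWithin (uniqueDiffWithinAt_Ici x)).symm

theorem PC1.of_contDiff {f : ℝ → ℝ} (hf : ContDiff ℝ 1 f) : PC1 f :=
  ⟨1, fun i => i, by simp, by simp, by simp, hf.continuous.continuousOn,
    fun _ _ => hf.contDiffOn⟩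

/-- The speed of a curve for the metric `dx² + dy² + cos²(dist((x,y),Δ)) dz²`, computed with
right derivatives. -/
def rightSpeed (Δ : Set (EuclideanSpace ℝ (Fin 2))) (x y z : ℝ → ℝ) (t : ℝ) : ℝ :=
  √((derivWithin x (Ici t) t) ^ 2 + (derivWithin y (Ici t) t) ^ 2 +
    cos (Metric.infDist (pt2 (x t) (y t)) Δ) ^ 2 * (derivWithin z (Ici t) t) ^ 2)

section Speed

variable {Δ : Set (EuclideanSpace ℝ (Fin 2))} {x y z : ℝ → ℝ}

theorem sLen_eq_integral_rightSpeed (hx : PC1 x) (hy : PC1 y) (hz : PC1 z) :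
    sLen Δ x y z = ∫ t in (0 : ℝ)..1, rightSpeed Δ x y z t := by
  refine intervalIntegral.integral_congr_ae ?_
  have h1 : ∀ᵐ t : ℝ, t ≠ 1 := by simp [ae_iff, measure_singleton]
  filter_upwards [hx.ae_deriv_eq, hy.ae_deriv_eq, hz.ae_deriv_eq, h1] with t hx hy hz h1 ht
  rw [uIoc_of_le zero_le_one] at ht
  have ht' : t ∈ Ico (0 : ℝ) 1 := ⟨ht.1.le, lt_of_le_of_ne ht.2 h1⟩
  simp only [rightSpeed, hx ht', hy ht', hz ht']

theorem rightSpeed_nonneg (t : ℝ) : 0 ≤ rightSpeed Δ x y z t := sqrt_nonneg _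

theorem continuous_pt2 : Continuous fun p : ℝ × ℝ => pt2 p.1 p.2 := by
  unfold pt2
  refine (PiLp.continuous_toLp 2 _).comp (continuous_pi fun i => ?_)
  fin_cases i
  · exact continuous_fst
  · exact continuous_snd

theorem integrableOn_rightSpeed (hx : PC1 x) (hy : PC1 y) (hz : PC1 z) :
    IntegrableOn (rightSpeed Δ x y z) (Icc 0 1) := by
  rw [integrableOn_Icc_iff_integrableOn_Ico]
  obtain ⟨A, hA⟩ := hx.exists_abs_derivWithin_le
  obtain ⟨B, hB⟩ := hy.exists_abs_derivWithin_le
  obtain ⟨C, hC⟩ := hz.exists_abs_derivWithin_le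
  refine ⟨?_, .restrict_of_bounded (C := √(A ^ 2 + B ^ 2 + 1 * C ^ 2)) (by simp) ?_⟩
  · have hxy : ContinuousOn (fun t => (x t, y t)) (Ico 0 1) :=
      (hx.continuousOn.prodMk hy.continuousOn).mono Ico_subset_Icc_self
    have hd : Continuous fun p : ℝ × ℝ => cos (Metric.infDist (pt2 p.1 p.2) Δ) ^ 2 :=
      (continuous_cos.comp ((Metric.continuous_infDist_pt Δ).comp continuous_pt2)).pow 2
    have hm := (hd.comp_continuousOn hxy).aemeasurable (μ := volume) measurableSet_Ico
    have hxm := ((measurable_derivWithin_Ici x).pow_const 2).aemeasurable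
      (μ := volume.restrict (Ico (0 : ℝ) 1))
    have hym := ((measurable_derivWithin_Ici y).pow_const 2).aemeasurable
      (μ := volume.restrict (Ico (0 : ℝ) 1))
    have hzm := ((measurable_derivWithin_Ici z).pow_const 2).aemeasurable
      (μ := volume.restrict (Ico (0 : ℝ) 1))
    exact ((hxm.add hym).add (hm.mul hzm)).sqrt.aestronglyMeasurable
  · filter_upwards [ae_restrict_mem measurableSet_Ico] with t ht
    rw [norm_of_nonneg (rightSpeed_nonneg t)]
    refine sqrt_le_sqrt ?_
    have hc : cos (Metric.infDist (pt2 (x t) (y t)) Δ) ^ 2 ≤ 1 := cos_sq_le_one _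
    have h1 := sq_le_sq' (abs_le.1 (hA t ht)).1 (abs_le.1 (hA t ht)).2
    have h2 := sq_le_sq' (abs_le.1 (hB t ht)).1 (abs_le.1 (hB t ht)).2
    have h3 := sq_le_sq' (abs_le.1 (hC t ht)).1 (abs_le.1 (hC t ht)).2
    gcongr

end Speed

theorem intervalIntegral_add_of_integrableOn_Icc {w : ℝ → ℝ}
    (hw : IntegrableOn w (Icc 0 1)) {t : ℝ} (ht : t ∈ Icc (0 : ℝ) 1) :
    (∫ s in (0 : ℝ)..t, w s) + ∫ s in t..1, w s = ∫ s in (0 : ℝ)..1, w s := by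
  refine intervalIntegral.integral_add_adjacent_intervals ?_ ?_
  · exact ((intervalIntegrable_iff_integrableOn_Icc_of_le ht.1).2
      (hw.mono_set (Icc_subset_Icc_right ht.2)))
  · exact ((intervalIntegrable_iff_integrableOn_Icc_of_le ht.2).2
      (hw.mono_set (Icc_subset_Icc_left ht.1)))

section Length

variable {Δ : Set (EuclideanSpace ℝ (Fin 2))} {x y z : ℝ → ℝ}

theorem linear_horizontal_le_integral (hx : PC1 x) (hy : PC1 y) (hz : PC1 z) {α β : ℝ}
    (hαβ : α ^ 2 + β ^ 2 = 1) {s t : ℝ} (hs : 0 ≤ s) (hst : s ≤ t) (ht : t ≤ 1) :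
    α * (x t - x s) + β * (y t - y s) ≤ ∫ τ in s..t, rightSpeed Δ x y z τ := by
  have hsub : Icc s t ⊆ Icc 0 1 := Icc_subset_Icc hs ht
  have key := intervalIntegral.sub_le_integral_of_hasDeriv_right_of_le (a := s) (b := t)
    (g := fun τ => α * x τ + β * y τ)
    (g' := fun τ => α * derivWithin x (Ici τ) τ + β * derivWithin y (Ici τ) τ) hst
    (((hx.continuousOn.const_mul α).add (hy.continuousOn.const_mul β)).mono hsub)
    (fun τ hτ => ?_) ((integrableOn_rightSpeed hx hy hz (Δ := Δ)).mono_set hsub) (fun τ hτ => ?_)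
  · linarith
  · have hτ' : τ ∈ Ico (0 : ℝ) 1 := ⟨hs.trans hτ.1.le, hτ.2.trans_le ht⟩
    exact (((hx.hasDerivWithinAt hτ').const_mul α).add
      ((hy.hasDerivWithinAt hτ').const_mul β)).mono Ioi_subset_Ici_self
  · refine le_sqrt_of_sq_le ?_
    set p := derivWithin x (Ici τ) τ
    set q := derivWithin y (Ici τ) τ
    have h1 : (α * p + β * q) ^ 2 + (α * q - β * p) ^ 2 = p ^ 2 + q ^ 2 := by
      linear_combination (p ^ 2 + q ^ 2) * hαβ
    have h2 : 0 ≤ cos (Metric.infDist (pt2 (x τ) (y τ)) Δ) ^ 2 * derivWithin z (Ici τ) τ ^ 2 := by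
      positivity
    nlinarith [sq_nonneg (α * q - β * p)]

theorem mul_abs_vertical_le_integral (hx : PC1 x) (hy : PC1 y) (hz : PC1 z) {c : ℝ} (hc0 : 0 ≤ c)
    (hc : ∀ p, c ≤ cos (Metric.infDist p Δ)) :
    c * |z 1 - z 0| ≤ ∫ τ in (0 : ℝ)..1, rightSpeed Δ x y z τ := by
  have main : ∀ ε : ℝ, ε ^ 2 = 1 → c * (ε * (z 1 - z 0)) ≤
      ∫ τ in (0 : ℝ)..1, rightSpeed Δ x y z τ := by
    intro ε hε
    have key := intervalIntegral.sub_le_integral_of_hasDeriv_right_of_le (a := 0) (b := 1)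
      (g := fun τ => (c * ε) * z τ)
      (g' := fun τ => (c * ε) * derivWithin z (Ici τ) τ) zero_le_one
      (hz.continuousOn.const_mul _)
      (fun τ hτ => ?_) (integrableOn_rightSpeed hx hy hz (Δ := Δ)) (fun τ hτ => ?_)
    · linarith
    · exact ((hz.hasDerivWithinAt (Ioo_subset_Ico_self hτ)).const_mul _).mono Ioi_subset_Ici_self
    · refine le_sqrt_of_sq_le ?_
      have h1 : c ^ 2 ≤ cos (Metric.infDist (pt2 (x τ) (y τ)) Δ) ^ 2 :=
        pow_le_pow_left₀ hc0 (hc _) 2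
      rw [mul_pow, mul_pow, hε, mul_one]
      have h2 := mul_le_mul_of_nonneg_right h1 (sq_nonneg (derivWithin z (Ici τ) τ))
      nlinarith [sq_nonneg (derivWithin x (Ici τ) τ), sq_nonneg (derivWithin y (Ici τ) τ)]
  rcases abs_cases (z 1 - z 0) with ⟨h, -⟩ | ⟨h, -⟩
  · rw [h]; simpa using main 1 (by norm_num)
  · rw [h]; simpa using main (-1) (by norm_num)

theorem two_mul_radius_le_integral_of_reflection (hx : PC1 x) (hy : PC1 y) (hz : PC1 z) {u v : ℝ}
    (hxe : x 1 = 2 * u - x 0) (hye : y 1 = 2 * v - y 0) {t : ℝ} (ht : t ∈ Icc (0 : ℝ) 1) :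
    2 * √((x t - u) ^ 2 + (y t - v) ^ 2) ≤ ∫ τ in (0 : ℝ)..1, rightSpeed Δ x y z τ := by
  set r := √((x t - u) ^ 2 + (y t - v) ^ 2) with hr
  have hr2 : r ^ 2 = (x t - u) ^ 2 + (y t - v) ^ 2 := sq_sqrt (by positivity)
  rcases eq_or_lt_of_le (sqrt_nonneg ((x t - u) ^ 2 + (y t - v) ^ 2)) with h0 | h0
  · rw [← hr] at h0
    rw [← h0, mul_zero]
    exact intervalIntegral.integral_nonneg zero_le_one fun _ _ => rightSpeed_nonneg _
  rw [← hr] at h0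
  have hunit : ((x t - u) / r) ^ 2 + ((y t - v) / r) ^ 2 = 1 := by
    field_simp
    exact hr2.symm
  have hunit' : (-((x t - u) / r)) ^ 2 + (-((y t - v) / r)) ^ 2 = 1 := by simpa using hunit
  have h1 := linear_horizontal_le_integral (Δ := Δ) hx hy hz hunit le_rfl ht.1 ht.2
  have h2 := linear_horizontal_le_integral (Δ := Δ) hx hy hz hunit' ht.1 ht.2 le_rfl
  rw [← intervalIntegral_add_of_integrableOn_Icc (integrableOn_rightSpeed hx hy hz) ht]
  refine le_trans (le_of_eq ?_) (add_le_add h1 h2)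
  rw [hxe, hye]
  field_simp
  linear_combination 2 * hr2

end Length

section Sphere

variable {E : Type*} [NormedAddCommGroup E] [InnerProductSpace ℝ E]

/-- A curve on the unit sphere joining two antipodal points has length at least `π`. -/
theorem pi_le_integral_of_antipodal {F : ℝ → E} {w : ℝ → ℝ} (hF : ContinuousOn F (Icc 0 1))
    (hnorm : ∀ t ∈ Icc (0 : ℝ) 1, ‖F t‖ = 1) (hw : IntegrableOn w (Icc 0 1))
    (hd : ∀ t ∈ Ioo (0 : ℝ) 1, ∃ F', HasDerivWithinAt F F' (Ioi t) t ∧ ‖F'‖ ≤ w t)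
    (hanti : F 1 = -F 0) : π ≤ ∫ t in (0 : ℝ)..1, w t := by
  choose! F' hF' hFw using hd
  set v := F 0 with hv
  have hv1 : ‖v‖ = 1 := hnorm 0 (by simp)
  set G : ℝ → ℝ := fun t => inner ℝ v (F t) with hG
  have hGc : ContinuousOn G (Icc 0 1) := continuousOn_const.inner hF
  have hG' : ∀ t ∈ Ioo (0 : ℝ) 1, HasDerivWithinAt G (inner ℝ v (F' t)) (Ioi t) t := by
    intro t ht
    simpa using (hasDerivWithinAt_const t (Ioi t) v).inner ℝ (hF' t ht)
  have hG0 : G 0 = 1 := by simp [hG, ← hv, hv1]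
  have hG1 : G 1 = -1 := by simp [hG, hanti, hv1]
  have horth : ∀ t ∈ Ioo (0 : ℝ) 1, inner ℝ (F t) (F' t) = 0 := by
    intro t ht
    have h1 := (hF' t ht).inner ℝ (hF' t ht)
    have h2 : HasDerivWithinAt (fun s => inner ℝ (F s) (F s)) (0 : ℝ) (Ioi t) t := by
      refine (hasDerivWithinAt_const t (Ioi t) (1 : ℝ)).congr_of_eventuallyEq ?_ ?_
      · filter_upwards [Ioo_mem_nhdsGT ht.2] with s hs
        rw [real_inner_self_eq_norm_sq, hnorm s ⟨ht.1.le.trans hs.1.le, hs.2.le⟩, one_pow]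
      · rw [real_inner_self_eq_norm_sq, hnorm t (Ioo_subset_Icc_self ht), one_pow]
    have h3 := (uniqueDiffWithinAt_Ioi t).eq_deriv _ h1 h2
    rw [real_inner_comm (F t) (F' t)] at h3
    linarith
  have hbound : ∀ t ∈ Ioo (0 : ℝ) 1, (inner ℝ v (F' t)) ^ 2 ≤ w t ^ 2 * (1 - G t ^ 2) := by
    intro t ht
    have h1 : inner ℝ v (F' t) = inner ℝ (v - G t • F t) (F' t) := by
      rw [inner_sub_left, inner_smul_left, horth t ht]; simp
    have h2 : ‖v - G t • F t‖ ^ 2 = 1 - G t ^ 2 := by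
      rw [norm_sub_sq_real, inner_smul_right, norm_smul, hv1, hnorm t (Ioo_subset_Icc_self ht)]
      simp only [hG, norm_eq_abs, mul_one, sq_abs, one_pow]
      ring
    rw [← h2, ← mul_pow, h1]
    refine sq_le_sq' ?_ ?_
    · have := neg_le_of_abs_le (abs_real_inner_le_norm (v - G t • F t) (F' t))
      nlinarith [mul_le_mul_of_nonneg_right (hFw t ht) (norm_nonneg (v - G t • F t))]
    · have := real_inner_le_norm (v - G t • F t) (F' t)
      nlinarith [mul_le_mul_of_nonneg_right (hFw t ht) (norm_nonneg (v - G t • F t))]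
  have hGle : ∀ t ∈ Icc (0 : ℝ) 1, G t ^ 2 ≤ 1 := by
    intro t ht
    have := abs_real_inner_le_norm v (F t)
    rw [hv1, hnorm t ht, one_mul] at this
    exact (sq_le_one_iff_abs_le_one _).2 this
  suffices main : ∀ θ, 0 < θ → θ < π / 2 → 2 * θ ≤ ∫ t in (0 : ℝ)..1, w t by
    refine le_of_forall_lt fun c hc => ?_
    have h0 : max c 0 < π := max_lt hc pi_pos
    have h1 := main ((max c 0 + π) / 4) (by linarith [pi_pos, le_max_right c 0]) (by linarith)
    linarith [le_max_left c 0]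
  intro θ hθ0 hθ1
  have hs1 : sin θ ^ 2 < 1 := by
    have := cos_pos_of_mem_Ioo ⟨by linarith, hθ1⟩
    nlinarith [sin_sq_add_cos_sq θ]
  have hs0 : 0 < sin θ := sin_pos_of_pos_of_lt_pi hθ0 (by linarith [pi_pos])
  have hlt : ∀ t ∈ Icc (0 : ℝ) 1, (sin θ * G t) ^ 2 < 1 := by
    intro t ht
    rw [mul_pow]
    nlinarith [hGle t ht, sq_nonneg (sin θ), sq_nonneg (G t)]
  have key := intervalIntegral.sub_le_integral_of_hasDeriv_right_of_le (a := 0) (b := 1)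
    (g := fun t => -arcsin (sin θ * G t))
    (g' := fun t => -(1 / √(1 - (sin θ * G t) ^ 2) * (sin θ * inner ℝ v (F' t)))) zero_le_one
    ((continuous_arcsin.comp_continuousOn (hGc.const_mul _)).neg)
    (fun t ht => ?_) hw (fun t ht => ?_)
  · rw [hG0, hG1] at key
    simp only [mul_neg, mul_one, arcsin_neg, neg_neg] at key
    rw [arcsin_sin (by linarith) hθ1.le] at key
    linarith
  · have hl := hlt t (Ioo_subset_Icc_self ht)
    rw [sq_lt_one_iff_abs_lt_one, abs_lt] at hl
    exact ((hasDerivAt_arcsin hl.1.ne' hl.2.ne).comp_hasDerivWithinAt t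
      ((hG' t ht).const_mul (sin θ))).neg
  · have hl := hlt t (Ioo_subset_Icc_self ht)
    have hpos : 0 < √(1 - (sin θ * G t) ^ 2) := sqrt_pos.2 (by linarith)
    have hw0 : 0 ≤ w t := (norm_nonneg _).trans (hFw t ht)
    rw [one_div, ← mul_neg, inv_mul_le_iff₀ hpos]
    refine abs_le_of_sq_le_sq' ?_ (by positivity) |>.2
    rw [neg_sq, mul_pow, mul_pow, sq_sqrt (by linarith)]
    have h1 := mul_le_mul_of_nonneg_left (hbound t ht) (sq_nonneg (sin θ))
    nlinarith [mul_nonneg (sub_nonneg.2 hs1.le) (sq_nonneg (w t))]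

end Sphere

section Join

theorem hasDerivWithinAt_mul_of_eq_zero {k X : ℝ → ℝ} {X' t : ℝ} {s : Set ℝ}
    (hk : ContinuousWithinAt k s t) (hX : HasDerivWithinAt X X' s t) (h0 : X t = 0) :
    HasDerivWithinAt (fun τ => k τ * X τ) (k t * X') s t := by
  rw [hasDerivWithinAt_iff_tendsto_slope] at hX ⊢
  refine ((hk.mono Set.sdiff_subset).tendsto.mul hX).congr fun τ => ?_
  simp only [slope_def_field, h0]
  ring

theorem sinc_mul_self (r : ℝ) : sinc r * r = sin r := by
  rcases eq_or_ne r 0 with rfl | h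
  · simp
  · rw [sinc_of_ne_zero h]; field_simp

theorem cos_eq_one_sub_sinc (r : ℝ) : cos r = 1 - sinc (r / 2) ^ 2 / 2 * r ^ 2 := by
  have h1 := cos_sq' (r / 2)
  have h2 := cos_two_mul (r / 2)
  have h3 := sinc_mul_self (r / 2)
  rw [mul_div_cancel₀ r two_ne_zero] at h2
  rw [h2, h1, ← h3]
  ring

theorem hasDerivAt_sinc_of_ne_zero {r : ℝ} (hr : r ≠ 0) :
    HasDerivAt sinc ((cos r * r - sin r) / r ^ 2) r := by
  have h := (hasDerivAt_sin r).div (hasDerivAt_id r) hr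
  simp only [id, mul_one] at h
  refine h.congr_of_eventuallyEq ?_
  filter_upwards [isOpen_ne.mem_nhds hr] with s hs
  exact sinc_of_ne_zero hs

/-- The map from cylindrical coordinates to the unit sphere of `ℝ⁴` given by
`(r e^{iθ}, z) ↦ (sin r e^{iθ}, cos r e^{iz})`. -/
def sphereMap (X Y z : ℝ) : EuclideanSpace ℝ (Fin 4) :=
  !₂[sinc √(X ^ 2 + Y ^ 2) * X, sinc √(X ^ 2 + Y ^ 2) * Y,
    cos √(X ^ 2 + Y ^ 2) * cos z, cos √(X ^ 2 + Y ^ 2) * sin z]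

theorem norm_sphereMap (X Y z : ℝ) : ‖sphereMap X Y z‖ = 1 := by
  have h1 := sinc_mul_self √(X ^ 2 + Y ^ 2)
  have h2 : √(X ^ 2 + Y ^ 2) ^ 2 = X ^ 2 + Y ^ 2 := sq_sqrt (by positivity)
  rw [EuclideanSpace.norm_eq, sqrt_eq_one]
  simp only [sphereMap, Fin.sum_univ_four, norm_eq_abs, sq_abs]
  simp
  set r := √(X ^ 2 + Y ^ 2)
  have h3 := sin_sq_add_cos_sq r
  rw [← h1] at h3
  linear_combination h3 + cos r ^ 2 * sin_sq_add_cos_sq z - sinc r ^ 2 * h2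

theorem sphereMap_antipodal (X Y z : ℝ) (k : ℤ) :
    sphereMap (-X) (-Y) (z + π + 2 * π * k) = -sphereMap X Y z := by
  have hc : cos (z + π + 2 * π * k) = -cos z := by
    rw [mul_comm (2 * π), cos_add_int_mul_two_pi, cos_add_pi]
  have hs : sin (z + π + 2 * π * k) = -sin z := by
    rw [mul_comm (2 * π), sin_add_int_mul_two_pi, sin_add_pi]
  ext i
  fin_cases i <;> simp [sphereMap, hc, hs]

theorem continuous_sphereMap :
    Continuous fun p : ℝ × ℝ × ℝ => sphereMap p.1 p.2.1 p.2.2 := by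
  unfold sphereMap
  refine (PiLp.continuous_toLp 2 _).comp (continuous_pi fun i => ?_)
  have := continuous_sinc
  fin_cases i <;> simp <;> fun_prop

theorem hasDerivWithinAt_sphereMap {X Y z : ℝ → ℝ} {X' Y' z' t : ℝ} {s : Set ℝ}
    (hX : HasDerivWithinAt X X' s t) (hY : HasDerivWithinAt Y Y' s t)
    (hz : HasDerivWithinAt z z' s t) :
    ∃ F', HasDerivWithinAt (fun τ => sphereMap (X τ) (Y τ) (z τ)) F' s t ∧
      ‖F'‖ ≤ √(X' ^ 2 + Y' ^ 2 + cos √(X t ^ 2 + Y t ^ 2) ^ 2 * z' ^ 2) := by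
  suffices h : ∃ a b c d : ℝ,
      HasDerivWithinAt (fun τ => sinc √(X τ ^ 2 + Y τ ^ 2) * X τ) a s t ∧
      HasDerivWithinAt (fun τ => sinc √(X τ ^ 2 + Y τ ^ 2) * Y τ) b s t ∧
      HasDerivWithinAt (fun τ => cos √(X τ ^ 2 + Y τ ^ 2) * cos (z τ)) c s t ∧
      HasDerivWithinAt (fun τ => cos √(X τ ^ 2 + Y τ ^ 2) * sin (z τ)) d s t ∧
      a ^ 2 + b ^ 2 + c ^ 2 + d ^ 2 ≤
        X' ^ 2 + Y' ^ 2 + cos √(X t ^ 2 + Y t ^ 2) ^ 2 * z' ^ 2 by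
    obtain ⟨a, b, c, d, ha, hb, hc, hd, hle⟩ := h
    refine ⟨!₂[a, b, c, d], ?_, ?_⟩
    · have hv : HasDerivWithinAt (fun τ => ![sinc √(X τ ^ 2 + Y τ ^ 2) * X τ,
          sinc √(X τ ^ 2 + Y τ ^ 2) * Y τ, cos √(X τ ^ 2 + Y τ ^ 2) * cos (z τ),
          cos √(X τ ^ 2 + Y τ ^ 2) * sin (z τ)]) ![a, b, c, d] s t := by
        refine hasDerivWithinAt_pi.2 fun i => ?_
        fin_cases i
        · exact ha
        · exact hb
        · exact hc
        · exact hd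
      exact (PiLp.continuousLinearEquiv 2 ℝ
        (fun _ : Fin 4 => ℝ)).symm.hasFDerivAt.comp_hasDerivWithinAt t hv
    · rw [EuclideanSpace.norm_eq]
      refine sqrt_le_sqrt ?_
      simpa [Fin.sum_univ_four] using hle
  have hcz := hz.cos
  have hsz := hz.sin
  have hN : HasDerivWithinAt (fun τ => X τ ^ 2 + Y τ ^ 2) (2 * (X t * X' + Y t * Y')) s t :=
    ((hX.pow 2).add (hY.pow 2)).congr_deriv (by push_cast; ring)
  have hR : ContinuousWithinAt (fun τ => √(X τ ^ 2 + Y τ ^ 2)) s t := by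
    have h1 := hX.continuousWithinAt
    have h2 := hY.continuousWithinAt
    fun_prop
  rcases eq_or_ne (X t ^ 2 + Y t ^ 2) 0 with h0 | h0
  · have hX0 : X t = 0 := by nlinarith [sq_nonneg (X t), sq_nonneg (Y t)]
    have hY0 : Y t = 0 := by nlinarith [sq_nonneg (X t), sq_nonneg (Y t)]
    have hk : ContinuousWithinAt (fun τ => sinc √(X τ ^ 2 + Y τ ^ 2)) s t :=
      continuous_sinc.continuousAt.comp_continuousWithinAt hR
    have hk2 : ContinuousWithinAt (fun τ => sinc (√(X τ ^ 2 + Y τ ^ 2) / 2) ^ 2 / 2) s t :=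
      ((continuous_sinc.continuousAt.comp_continuousWithinAt (hR.div_const 2)).pow 2).div_const 2
    have ha := hasDerivWithinAt_mul_of_eq_zero hk hX hX0
    have hb := hasDerivWithinAt_mul_of_eq_zero hk hY hY0
    have hc : HasDerivWithinAt (fun τ => cos √(X τ ^ 2 + Y τ ^ 2)) 0 s t := by
      have h1 := hasDerivWithinAt_mul_of_eq_zero (hk2.mul hX.continuousWithinAt) hX hX0
      have h2 := hasDerivWithinAt_mul_of_eq_zero (hk2.mul hY.continuousWithinAt) hY hY0
      have h3 := (h1.add h2).const_sub 1
      simp only [Pi.mul_apply, hX0, hY0, mul_zero, zero_mul, add_zero, neg_zero] at h3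
      refine h3.congr_of_eventuallyEq (Filter.Eventually.of_forall fun τ => ?_) ?_
      · simp only [Pi.add_apply]
        rw [cos_eq_one_sub_sinc, sq_sqrt (by positivity)]
        ring
      · simp [hX0, hY0]
    refine ⟨_, _, _, _, ha, hb, hc.mul hcz, hc.mul hsz, ?_⟩
    simp only [h0, sqrt_zero, sinc_zero, cos_zero]
    nlinarith [sin_sq_add_cos_sq (z t)]
  · set r := √(X t ^ 2 + Y t ^ 2) with hr
    have hr2 : r ^ 2 = X t ^ 2 + Y t ^ 2 := sq_sqrt (by positivity)
    have hr0 : r ≠ 0 := fun h => h0 (by rw [← hr2, h]; simp)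
    have hRd : HasDerivWithinAt (fun τ => √(X τ ^ 2 + Y τ ^ 2))
        ((X t * X' + Y t * Y') / r) s t := by
      refine (hN.sqrt h0).congr_deriv ?_
      rw [← hr]
      field_simp
    have hk := (hasDerivAt_sinc_of_ne_zero hr0).comp_hasDerivWithinAt t hRd
    have hc := hRd.cos
    refine ⟨_, _, _, _, hk.mul hX, hk.mul hY, hc.mul hcz, hc.mul hsz, ?_⟩
    simp only [Function.comp_apply]
    rw [← hr]
    set R' := (X t * X' + Y t * Y') / r with hR'
    set k := sinc r with hkdef
    have hkr : k * r = sin r := sinc_mul_self r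
    set k' := (cos r * r - sin r) / r ^ 2 with hk'
    have hk'r : k' * r = cos r - k := by
      rw [hk', ← hkr]; field_simp
    have hXY : X t * X' + Y t * Y' = R' * r := by rw [hR']; field_simp
    have hR'le : R' ^ 2 ≤ X' ^ 2 + Y' ^ 2 := by
      rw [hR', div_pow, div_le_iff₀ (by positivity), hr2]
      nlinarith [sq_nonneg (X t * Y' - Y t * X')]
    have hk1 : k ^ 2 ≤ 1 := (sq_le_one_iff_abs_le_one _).2 (abs_sinc_le_one r)
    have e1 : (k' * R' * X t + k * X') ^ 2 + (k' * R' * Y t + k * Y') ^ 2 =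
        R' ^ 2 * (cos r ^ 2 - k ^ 2) + k ^ 2 * (X' ^ 2 + Y' ^ 2) := by
      have : cos r = k' * r + k := by linarith
      rw [this]
      linear_combination (- k' ^ 2 * R' ^ 2) * hr2 + 2 * k' * R' * k * hXY
    have e2 : (-sin r * R' * cos (z t) + cos r * (-sin (z t) * z')) ^ 2 +
        (-sin r * R' * sin (z t) + cos r * (cos (z t) * z')) ^ 2 =
        sin r ^ 2 * R' ^ 2 + cos r ^ 2 * z' ^ 2 := by
      linear_combination (sin r ^ 2 * R' ^ 2 + cos r ^ 2 * z' ^ 2) * sin_sq_add_cos_sq (z t)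
    have e3 : R' ^ 2 * (1 - k ^ 2) ≤ (X' ^ 2 + Y' ^ 2) * (1 - k ^ 2) :=
      mul_le_mul_of_nonneg_right hR'le (by linarith)
    have e4 := sin_sq_add_cos_sq r
    nlinarith

end Join

section Lattice

variable {Δ : Set (EuclideanSpace ℝ (Fin 2))} {x y z : ℝ → ℝ}

theorem dist_pt2 (x y u v : ℝ) : dist (pt2 x y) (pt2 u v) = √((x - u) ^ 2 + (y - v) ^ 2) := by
  simp [pt2, EuclideanSpace.dist_eq, Fin.sum_univ_two, Real.dist_eq, sq_abs]

/-- A curve joining a point to its image under a screw motion by an odd multiple of `π` around the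
axis over a lattice point has length at least `π`. -/
theorem pi_le_integral_of_screw (hx : PC1 x) (hy : PC1 y) (hz : PC1 z) {u v : ℝ} {k : ℤ}
    (hmem : pt2 u v ∈ Δ) (hxe : x 1 = 2 * u - x 0) (hye : y 1 = 2 * v - y 0)
    (hze : z 1 = z 0 + π + 2 * π * k) :
    π ≤ ∫ τ in (0 : ℝ)..1, rightSpeed Δ x y z τ := by
  by_cases hfar : ∃ t ∈ Icc (0 : ℝ) 1, π / 2 ≤ √((x t - u) ^ 2 + (y t - v) ^ 2)
  · obtain ⟨t, ht, hrt⟩ := hfar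
    have := two_mul_radius_le_integral_of_reflection (Δ := Δ) hx hy hz hxe hye ht
    linarith
  push Not at hfar
  have hcont : ContinuousOn (fun t => sphereMap (x t - u) (y t - v) (z t)) (Icc 0 1) := by
    have h : ContinuousOn (fun t => (x t - u, y t - v, z t)) (Icc 0 1) :=
      (hx.continuousOn.sub continuousOn_const).prodMk
        ((hy.continuousOn.sub continuousOn_const).prodMk hz.continuousOn)
    have h2 := continuous_sphereMap.comp_continuousOn h
    exact h2
  refine pi_le_integral_of_antipodal (F := fun t => sphereMap (x t - u) (y t - v) (z t)) hcont
    (fun t _ => norm_sphereMap _ _ _) (integrableOn_rightSpeed hx hy hz) ?_ ?_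
  · intro t ht
    have ht' := Ioo_subset_Ico_self ht
    obtain ⟨F', hF', hle⟩ := hasDerivWithinAt_sphereMap
      (((hx.hasDerivWithinAt ht').sub_const u).mono Ioi_subset_Ici_self)
      (((hy.hasDerivWithinAt ht').sub_const v).mono Ioi_subset_Ici_self)
      ((hz.hasDerivWithinAt ht').mono Ioi_subset_Ici_self)
    refine ⟨F', hF', hle.trans (sqrt_le_sqrt ?_)⟩
    have hr := hfar t (Ioo_subset_Icc_self ht)
    have hd : Metric.infDist (pt2 (x t) (y t)) Δ ≤ √((x t - u) ^ 2 + (y t - v) ^ 2) :=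
      (Metric.infDist_le_dist_of_mem hmem).trans_eq (dist_pt2 _ _ _ _)
    have hcos : cos √((x t - u) ^ 2 + (y t - v) ^ 2) ≤ cos (Metric.infDist (pt2 (x t) (y t)) Δ) :=
      cos_le_cos_of_nonneg_of_le_pi Metric.infDist_nonneg (by linarith [pi_pos]) hd
    have hcos0 : 0 ≤ cos √((x t - u) ^ 2 + (y t - v) ^ 2) :=
      cos_nonneg_of_mem_Icc ⟨by linarith [sqrt_nonneg ((x t - u) ^ 2 + (y t - v) ^ 2), pi_pos],
        hr.le⟩
    gcongr
  · rw [← sphereMap_antipodal _ _ _ k, hxe, hye, hze]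
    congr 1 <;> ring

theorem abs_sub_mul_round_le {a : ℝ} (ha : 0 < a) (x : ℝ) :
    |x - 2 * a * round (x / (2 * a))| ≤ a := by
  have h := abs_sub_round (x / (2 * a))
  have h2 : x - 2 * a * round (x / (2 * a)) = 2 * a * (x / (2 * a) - round (x / (2 * a))) := by
    field_simp
  rw [h2, abs_mul, abs_of_pos (by linarith)]
  nlinarith

theorem infDist_ΔsqE_le {a : ℝ} (ha : 0 < a) (p : EuclideanSpace ℝ (Fin 2)) :
    Metric.infDist p (ΔsqE a) ≤ a * √2 := by
  have hp : p = pt2 (p 0) (p 1) := by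
    ext i
    fin_cases i <;> simp [pt2]
  have hmem : pt2 (2 * a * round (p 0 / (2 * a))) (2 * a * round (p 1 / (2 * a))) ∈ ΔsqE a :=
    ⟨_, _, rfl⟩
  refine (Metric.infDist_le_dist_of_mem hmem).trans ?_
  nth_rewrite 1 [hp]
  rw [dist_pt2, sqrt_le_left (by positivity), mul_pow, sq_sqrt (by norm_num)]
  have h0 := sq_le_sq' (abs_le.1 (abs_sub_mul_round_le ha (p 0))).1
    (abs_le.1 (abs_sub_mul_round_le ha (p 0))).2
  have h1 := sq_le_sq' (abs_le.1 (abs_sub_mul_round_le ha (p 1))).1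
    (abs_le.1 (abs_sub_mul_round_le ha (p 1))).2
  linarith

theorem cos_le_cos_infDist_ΔsqE {a : ℝ} (ha : 0 < a) (ha' : a * √2 ≤ π)
    (p : EuclideanSpace ℝ (Fin 2)) : cos (a * √2) ≤ cos (Metric.infDist p (ΔsqE a)) :=
  cos_le_cos_of_nonneg_of_le_pi Metric.infDist_nonneg ha' (infDist_ΔsqE_le ha p)

theorem abs_horizontal_le_integral (hx : PC1 x) (hy : PC1 y) (hz : PC1 z) :
    |x 1 - x 0| ≤ ∫ τ in (0 : ℝ)..1, rightSpeed Δ x y z τ ∧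
      |y 1 - y 0| ≤ ∫ τ in (0 : ℝ)..1, rightSpeed Δ x y z τ := by
  have key : ∀ α β : ℝ, α ^ 2 + β ^ 2 = 1 → α * (x 1 - x 0) + β * (y 1 - y 0) ≤
      ∫ τ in (0 : ℝ)..1, rightSpeed Δ x y z τ := fun α β h =>
    linear_horizontal_le_integral hx hy hz h le_rfl zero_le_one le_rfl
  refine ⟨abs_le'.2 ⟨?_, ?_⟩, abs_le'.2 ⟨?_, ?_⟩⟩
  · simpa using key 1 0 (by norm_num)
  · simpa using key (-1) 0 (by norm_num)
  · simpa using key 0 1 (by norm_num)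
  · simpa using key 0 (-1) (by norm_num)

theorem mem_Γsq_cases {a : ℝ} {g : Equiv.Perm (ℝ × ℝ × ℝ)} (hg : g ∈ Γsq a) :
    ∃ k₁ k₂ k₃ : ℤ,
      (∀ p, g p = (p.1 + 4 * a * k₁, p.2.1 + 4 * a * k₂, p.2.2 + 2 * π * k₃)) ∨
      (∀ p, g p = (-p.1 + 4 * a * k₁, -p.2.1 + 4 * a * k₂, p.2.2 + π + 2 * π * k₃)) := by
  induction hg using Subgroup.closure_induction with
  | mem g hg =>
    rcases hg with ⟨w, ⟨k₁, k₂, k₃, rfl⟩, rfl⟩ | hg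
    · refine ⟨k₁, k₂, k₃, Or.inl fun p => ?_⟩
      simp [Prod.ext_iff, add_comm]
    · rw [mem_singleton_iff] at hg
      subst hg
      exact ⟨0, 0, 0, Or.inr fun p => by simp [sigma0Perm]⟩
  | one => exact ⟨0, 0, 0, Or.inl fun p => by simp⟩
  | mul g h _ _ ihg ihh =>
    obtain ⟨k₁, k₂, k₃, hk⟩ := ihg
    obtain ⟨l₁, l₂, l₃, hl⟩ := ihh
    rcases hk with hk | hk <;> rcases hl with hl | hl
    · refine ⟨k₁ + l₁, k₂ + l₂, k₃ + l₃, Or.inl fun p => ?_⟩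
      rw [Equiv.Perm.mul_apply, hl, hk]
      ext <;> push_cast <;> ring
    · refine ⟨k₁ + l₁, k₂ + l₂, k₃ + l₃, Or.inr fun p => ?_⟩
      rw [Equiv.Perm.mul_apply, hl, hk]
      ext <;> push_cast <;> ring
    · refine ⟨k₁ - l₁, k₂ - l₂, k₃ + l₃, Or.inr fun p => ?_⟩
      rw [Equiv.Perm.mul_apply, hl, hk]
      ext <;> push_cast <;> ring
    · refine ⟨k₁ - l₁, k₂ - l₂, k₃ + l₃ + 1, Or.inl fun p => ?_⟩
      rw [Equiv.Perm.mul_apply, hl, hk]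
      ext <;> push_cast <;> ring
  | inv g _ ih =>
    obtain ⟨k₁, k₂, k₃, hk | hk⟩ := ih
    · refine ⟨-k₁, -k₂, -k₃, Or.inl fun p => ?_⟩
      rw [Equiv.Perm.inv_eq_iff_eq, hk]
      ext <;> push_cast <;> ring
    · refine ⟨k₁, k₂, -k₃ - 1, Or.inr fun p => ?_⟩
      rw [Equiv.Perm.inv_eq_iff_eq, hk]
      ext <;> push_cast <;> ring

theorem one_le_abs_intCast {k : ℤ} (hk : k ≠ 0) : (1 : ℝ) ≤ |(k : ℝ)| := by
  exact_mod_cast Int.one_le_abs hk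

theorem four_mul_le_sLen {a : ℝ} (ha : 0 < a) (ha' : a * √2 ≤ π) (haπ : 4 * a ≤ π)
    (hac : 2 * a = π * cos (a * √2)) {g : Equiv.Perm (ℝ × ℝ × ℝ)} (hg : g ∈ Γsq a) (hg1 : g ≠ 1)
    (hx : PC1 x) (hy : PC1 y) (hz : PC1 z) (hend : (x 1, y 1, z 1) = g (x 0, y 0, z 0)) :
    4 * a ≤ sLen (ΔsqE a) x y z := by
  rw [sLen_eq_integral_rightSpeed hx hy hz]
  obtain ⟨k₁, k₂, k₃, hk | hk⟩ := mem_Γsq_cases hg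
  · rw [hk] at hend
    simp only [Prod.mk.injEq] at hend
    obtain ⟨h1, h2, h3⟩ := hend
    by_cases hk1 : k₁ = 0
    · by_cases hk2 : k₂ = 0
      · have hk3 : k₃ ≠ 0 := by
          rintro rfl
          exact hg1 (Equiv.ext fun p => by simp [hk, hk1, hk2])
        have hcos : cos (a * √2) * π = 2 * a := by linarith
        have hcos0 : 0 ≤ cos (a * √2) := by
          by_contra! h
          nlinarith [pi_pos]
        refine le_trans ?_ (mul_abs_vertical_le_integral hx hy hz hcos0
          (cos_le_cos_infDist_ΔsqE ha ha'))
        rw [h3, add_sub_cancel_left, abs_mul, abs_of_pos two_pi_pos]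
        calc 4 * a = cos (a * √2) * (2 * π * 1) := by linarith
          _ ≤ _ := by gcongr; exact one_le_abs_intCast hk3
      · refine le_trans ?_ (abs_horizontal_le_integral hx hy hz).2
        rw [h2, add_sub_cancel_left, abs_mul, abs_of_pos (by linarith)]
        exact le_mul_of_one_le_right (by linarith) (one_le_abs_intCast hk2)
    · refine le_trans ?_ (abs_horizontal_le_integral hx hy hz).1
      rw [h1, add_sub_cancel_left, abs_mul, abs_of_pos (by linarith)]
      exact le_mul_of_one_le_right (by linarith) (one_le_abs_intCast hk1)
  · rw [hk] at hend
    simp only [Prod.mk.injEq] at hend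
    obtain ⟨h1, h2, h3⟩ := hend
    exact haπ.trans (pi_le_integral_of_screw hx hy hz ⟨k₁, k₂, rfl⟩ (by rw [h1]; ring)
      (by rw [h2]; ring) h3)

theorem sInf_sLen_eq {a : ℝ} (ha : 0 < a) (ha' : a * √2 ≤ π) (haπ : 4 * a ≤ π)
    (hac : 2 * a = π * cos (a * √2)) :
    sInf {L : ℝ | ∃ g ∈ Γsq a, g ≠ 1 ∧ ∃ γ₁ γ₂ γ₃ : ℝ → ℝ,
      PC1 γ₁ ∧ PC1 γ₂ ∧ PC1 γ₃ ∧
      (γ₁ 1, γ₂ 1, γ₃ 1) = g (γ₁ 0, γ₂ 0, γ₃ 0) ∧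
      L = sLen (ΔsqE a) γ₁ γ₂ γ₃} = 4 * a := by
  refine IsLeast.csInf_eq ⟨?_, ?_⟩
  · refine ⟨Equiv.addLeft (4 * a, 0, 0), ?_, ?_, fun t => 4 * a * t, fun _ => 0, fun _ => 0,
      PC1.of_contDiff (by fun_prop), PC1.of_contDiff (by fun_prop), PC1.of_contDiff (by fun_prop),
      by simp, ?_⟩
    · exact Subgroup.subset_closure (Or.inl ⟨_, ⟨1, 0, 0, by simp⟩, rfl⟩)
    · intro h
      have := congrArg (fun e : Equiv.Perm (ℝ × ℝ × ℝ) => (e 0).1) h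
      simp [ha.ne'] at this
    · have hd : ∀ t : ℝ, deriv (fun t => 4 * a * t) t = 4 * a := fun t => by simp
      simp only [sLen, hd, deriv_const]
      simp [sqrt_sq (by linarith : (0 : ℝ) ≤ 4 * a)]
  · rintro L ⟨g, hg, hg1, x, y, z, hx, hy, hz, hend, rfl⟩
    exact four_mul_le_sLen ha ha' haπ hac hg hg1 hx hy hz hend

end Lattice

section Taylor

theorem nonneg_of_hasDerivAt_nonneg {f f' : ℝ → ℝ} (hf : ∀ x, HasDerivAt f (f' x) x)
    (hf' : ∀ x, 0 ≤ x → 0 ≤ f' x) (h0 : f 0 = 0) {x : ℝ} (hx : 0 ≤ x) : 0 ≤ f x := by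
  have hm : MonotoneOn f (Ici 0) := by
    refine monotoneOn_of_hasDerivWithinAt_nonneg (f' := f') (convex_Ici 0)
      (fun y _ => (hf y).continuousAt.continuousWithinAt) (fun y _ => (hf y).hasDerivWithinAt) ?_
    intro y hy
    rw [interior_Ici] at hy
    exact hf' y (le_of_lt hy)
  rw [← h0]
  exact hm (mem_Ici.2 le_rfl) hx hx

theorem sub_cube_div_six_le_sin {x : ℝ} (hx : 0 ≤ x) : x - x ^ 3 / 6 ≤ sin x := by
  have h := nonneg_of_hasDerivAt_nonneg (f := fun y => sin y - (y - y ^ 3 / 6))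
    (f' := fun y => cos y - (1 - y ^ 2 / 2))
    (fun y => by
      refine ((hasDerivAt_sin y).sub ((hasDerivAt_id y).sub
        (((hasDerivAt_id y).pow 3).div_const 6))).congr_deriv ?_
      simp only [id]; push_cast; ring)
    (fun y _ => by linarith [one_sub_sq_div_two_le_cos (x := y)]) (by simp) hx
  linarith

theorem cos_le_taylor_four {x : ℝ} (hx : 0 ≤ x) : cos x ≤ 1 - x ^ 2 / 2 + x ^ 4 / 24 := by
  have h := nonneg_of_hasDerivAt_nonneg (f := fun y => (1 - y ^ 2 / 2 + y ^ 4 / 24) - cos y)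
    (f' := fun y => sin y - (y - y ^ 3 / 6))
    (fun y => by
      refine ((((((hasDerivAt_id y).pow 2).div_const 2).const_sub 1).add
        (((hasDerivAt_id y).pow 4).div_const 24)).sub (hasDerivAt_cos y)).congr_deriv ?_
      simp only [id]; push_cast; ring)
    (fun y hy => by linarith [sub_cube_div_six_le_sin hy]) (by simp) hx
  linarith

theorem sin_le_taylor_five {x : ℝ} (hx : 0 ≤ x) : sin x ≤ x - x ^ 3 / 6 + x ^ 5 / 120 := by
  have h := nonneg_of_hasDerivAt_nonneg (f := fun y => (y - y ^ 3 / 6 + y ^ 5 / 120) - sin y)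
    (f' := fun y => (1 - y ^ 2 / 2 + y ^ 4 / 24) - cos y)
    (fun y => by
      refine ((((hasDerivAt_id y).sub (((hasDerivAt_id y).pow 3).div_const 6)).add
        (((hasDerivAt_id y).pow 5).div_const 120)).sub (hasDerivAt_sin y)).congr_deriv ?_
      simp only [id]; push_cast; ring)
    (fun y hy => by linarith [cos_le_taylor_four hy]) (by simp) hx
  linarith

theorem taylor_six_le_cos {x : ℝ} (hx : 0 ≤ x) :
    1 - x ^ 2 / 2 + x ^ 4 / 24 - x ^ 6 / 720 ≤ cos x := by
  have h := nonneg_of_hasDerivAt_nonneg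
    (f := fun y => cos y - (1 - y ^ 2 / 2 + y ^ 4 / 24 - y ^ 6 / 720))
    (f' := fun y => (y - y ^ 3 / 6 + y ^ 5 / 120) - sin y)
    (fun y => by
      refine ((hasDerivAt_cos y).sub ((((((hasDerivAt_id y).pow 2).div_const 2).const_sub 1).add
        (((hasDerivAt_id y).pow 4).div_const 24)).sub
        (((hasDerivAt_id y).pow 6).div_const 720))).congr_deriv ?_
      simp only [id]; push_cast; ring)
    (fun y hy => by linarith [sin_le_taylor_five hy]) (by simp) hx
  linarith

end Taylor

section Volume

theorem setIntegral_sqCell (a : ℝ) :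
    ∫ p in sqCell a, cos ‖p‖ =
      ∫ q in Icc (-a) a ×ˢ Icc (-a) a, cos √(q.1 ^ 2 + q.2 ^ 2) := by
  have hmp := (volume_preserving_finTwoArrow ℝ).comp
    (EuclideanSpace.volume_preserving_symm_measurableEquiv_toLp (Fin 2))
  have hemb : MeasurableEmbedding
      (MeasurableEquiv.finTwoArrow ∘ (MeasurableEquiv.toLp 2 (Fin 2 → ℝ)).symm) :=
    MeasurableEquiv.finTwoArrow.measurableEmbedding.comp (MeasurableEquiv.measurableEmbedding _)
  rw [← hmp.setIntegral_preimage_emb hemb]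
  have hset : sqCell a = (MeasurableEquiv.finTwoArrow ∘
      (MeasurableEquiv.toLp 2 (Fin 2 → ℝ)).symm) ⁻¹' (Icc (-a) a ×ˢ Icc (-a) a) := by
    ext p
    rfl
  rw [← hset]
  congr 1
  ext p
  rw [EuclideanSpace.norm_eq, Fin.sum_univ_two]
  simp only [norm_eq_abs, sq_abs]
  rfl

theorem setIntegral_Icc_even_quartic {a : ℝ} (ha : 0 ≤ a) (b c d : ℝ) :
    ∫ y in Icc (-a) a, (b + c * y ^ 2 + d * y ^ 4) =
      2 * (b * a + c * a ^ 3 / 3 + d * a ^ 5 / 5) := by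
  rw [integral_Icc_eq_integral_Ioc, ← intervalIntegral.integral_of_le (by linarith),
    intervalIntegral.integral_eq_sub_of_hasDerivAt
      (f := fun y => b * y + c * y ^ 3 / 3 + d * y ^ 5 / 5)]
  · ring
  · intro y _
    refine ((((hasDerivAt_id y).const_mul b).add
      ((((hasDerivAt_id y).pow 3).const_mul c).div_const 3)).add
      ((((hasDerivAt_id y).pow 5).const_mul d).div_const 5)).congr_deriv ?_
    simp only [id]; push_cast; ring
  · exact Continuous.intervalIntegrable (by fun_prop) _ _

theorem setIntegral_sqCell_le {a : ℝ} (ha : 0 ≤ a) :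
    ∫ p in sqCell a, cos ‖p‖ ≤ 4 * a ^ 2 - 4 * a ^ 4 / 3 + 14 * a ^ 6 / 135 := by
  rw [setIntegral_sqCell]
  have hcomp : IsCompact (Icc (-a) a ×ˢ Icc (-a) a) := isCompact_Icc.prod isCompact_Icc
  have hint : IntegrableOn (fun q : ℝ × ℝ => (1 - q.1 ^ 2 / 2 + q.1 ^ 4 / 24) +
      (-1 / 2 + q.1 ^ 2 / 12) * q.2 ^ 2 + 1 / 24 * q.2 ^ 4) (Icc (-a) a ×ˢ Icc (-a) a) :=
    ContinuousOn.integrableOn_compact hcomp (by fun_prop)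
  refine (setIntegral_mono (ContinuousOn.integrableOn_compact hcomp (by fun_prop)) hint
    fun q => ?_).trans_eq ?_
  · refine (cos_le_taylor_four (sqrt_nonneg _)).trans_eq ?_
    rw [show √(q.1 ^ 2 + q.2 ^ 2) ^ 4 = (√(q.1 ^ 2 + q.2 ^ 2) ^ 2) ^ 2 by ring,
      sq_sqrt (by positivity)]
    ring
  · rw [Measure.volume_eq_prod] at hint ⊢
    rw [setIntegral_prod _ hint]
    simp only [setIntegral_Icc_even_quartic ha]
    rw [← setIntegral_congr_fun (f := fun x => (2 * a - a ^ 3 / 3 + a ^ 5 / 60) +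
      (-a + a ^ 3 / 18) * x ^ 2 + a / 12 * x ^ 4) measurableSet_Icc (fun x _ => by ring),
      setIntegral_Icc_even_quartic ha]
    ring

end Volume

section Parameter

theorem exists_two_mul_eq_pi_mul_cos :
    ∃ a : ℝ, 0 < a ∧ a < π / (2 * √2) ∧ 2 * a = π * cos (a * √2) := by
  have hs : 0 < √2 := by positivity
  have hb : 0 < π / (2 * √2) := by positivity
  have hend : π / (2 * √2) * √2 = π / 2 := by field_simp
  obtain ⟨a, ha, h⟩ := intermediate_value_Ioo hb.le
    (f := fun a => 2 * a - π * cos (a * √2)) (by fun_prop)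
    (show (0 : ℝ) ∈ Ioo _ _ by
      simp only [hend, cos_pi_div_two]
      constructor <;> simp <;> positivity)
  exact ⟨a, ha.1, ha.2, by simpa [sub_eq_zero] using h⟩

variable {a : ℝ}

theorem four_mul_le_pi (ha : 0 < a) (ha' : a * √2 ≤ π)
    (hac : 2 * a = π * cos (a * √2)) : 4 * a ≤ π := by
  by_contra! h
  have hs : (4 : ℝ) / 3 ≤ √2 := le_sqrt_of_sq_le (by norm_num)
  have hc : cos (a * √2) ≤ cos (π / 3) := by
    refine cos_le_cos_of_nonneg_of_le_pi (by positivity) ha' ?_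
    nlinarith
  rw [cos_pi_div_three] at hc
  nlinarith [pi_pos]

theorem three_quarters_le (ha : 0 < a) (hac : 2 * a = π * cos (a * √2)) : 3 / 4 ≤ a := by
  by_contra! h
  have h2 : √2 ^ 2 = 2 := sq_sqrt (by norm_num)
  have hc := taylor_six_le_cos (x := a * √2) (by positivity)
  have e4 : (a * √2) ^ 4 = 4 * (a ^ 2) ^ 2 := by
    rw [show (a * √2) ^ 4 = a ^ 4 * (√2 ^ 2) ^ 2 by ring, h2]; ring
  have e6 : (a * √2) ^ 6 = 8 * (a ^ 2) ^ 3 := by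
    rw [show (a * √2) ^ 6 = a ^ 6 * (√2 ^ 2) ^ 3 by ring, h2]; ring
  rw [mul_pow, h2, e4, e6] at hc
  have hs : a ^ 2 ≤ 9 / 16 := by nlinarith
  have hs0 : 0 ≤ a ^ 2 := sq_nonneg a
  set s := a ^ 2
  have hc2 : 0.48 ≤ cos (a * √2) := by
    refine le_trans ?_ hc
    nlinarith [mul_nonneg hs0 hs0, mul_nonneg hs0 (sub_nonneg.2 hs),
      mul_nonneg (mul_nonneg hs0 hs0) (sub_nonneg.2 hs)]
  nlinarith [pi_gt_d2]

theorem volume_lt_systole_cube (ha : 3 / 4 ≤ a) (ha1 : a ≤ 1) :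
    2 / √3 * (4 * π * ∫ p in sqCell a, cos ‖p‖) < (4 * a) ^ 3 := by
  have hI := setIntegral_sqCell_le (a := a) (by linarith)
  have h3 : 2 / √3 ≤ 1.155 := by
    rw [div_le_iff₀ (by positivity)]
    have : (1.732 : ℝ) ≤ √3 := le_sqrt_of_sq_le (by norm_num)
    linarith
  have hπ := pi_lt_d4
  set I := ∫ p in sqCell a, cos ‖p‖
  have hQ : 4 * a ^ 2 - 4 * a ^ 4 / 3 + 14 * a ^ 6 / 135 =
      a ^ 2 * (4 - 4 * a ^ 2 / 3 + 14 * a ^ 4 / 135) := by ring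
  rw [hQ] at hI
  have hs : 9 / 16 ≤ a ^ 2 := by nlinarith
  have hs1 : a ^ 2 ≤ 1 := by nlinarith
  have hP : 4 - 4 * a ^ 2 / 3 + 14 * a ^ 4 / 135 ≤ 3.283 := by
    nlinarith [mul_nonneg (sub_nonneg.2 hs) (sub_nonneg.2 hs1)]
  have hI2 : I ≤ a ^ 2 * 3.283 := hI.trans (by gcongr)
  have hc : 2 / √3 * (4 * π) ≤ 1.155 * (4 * 3.1416) := by gcongr
  calc 2 / √3 * (4 * π * I) = 2 / √3 * (4 * π) * I := by ring
    _ ≤ 2 / √3 * (4 * π) * (a ^ 2 * 3.283) := by gcongr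
    _ ≤ 1.155 * (4 * 3.1416) * (a ^ 2 * 3.283) := by gcongr
    _ < (4 * a) ^ 3 := by nlinarith [mul_nonneg (sq_nonneg a) (sub_nonneg.2 ha)]

end Parameter

/-- there exists `a ∈ (0, π/(2√2))` with `2a = π cos(a√2)`; for any such `a`,
the systole of `(C₂, g_c)` equals `4a` and, with `V = 4π∫_{[−a,a]²} cos‖p‖ dp` its volume,
`(4a)³ > (2/√3)·V`, i.e. the systolic ratio of `(C₂, g_c)` exceeds `2/√3` (≈ 1.18). -/
theorem C2_square_beats_flat :
    (∃ a : ℝ, 0 < a ∧ a < π / (2 * Real.sqrt 2) ∧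
      2 * a = π * Real.cos (a * Real.sqrt 2)) ∧
    ∀ a : ℝ, 0 < a → a < π / (2 * Real.sqrt 2) →
      2 * a = π * Real.cos (a * Real.sqrt 2) →
      (sInf {L : ℝ | ∃ g ∈ Γsq a, g ≠ 1 ∧ ∃ γ₁ γ₂ γ₃ : ℝ → ℝ,
          PC1 γ₁ ∧ PC1 γ₂ ∧ PC1 γ₃ ∧
          (γ₁ 1, γ₂ 1, γ₃ 1) = g (γ₁ 0, γ₂ 0, γ₃ 0) ∧
          L = sLen (ΔsqE a) γ₁ γ₂ γ₃} = 4 * a ∧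
        (4 * a) ^ 3 > 2 / Real.sqrt 3 * (4 * π * ∫ p in sqCell a, Real.cos ‖p‖)) := by
  refine ⟨exists_two_mul_eq_pi_mul_cos, fun a ha hlt hac => ?_⟩
  have ha' : a * √2 ≤ π := by
    rw [lt_div_iff₀ (by positivity)] at hlt
    nlinarith [pi_pos]
  have haπ := four_mul_le_pi ha ha' hac
  exact ⟨sInf_sLen_eq ha ha' haπ hac,
    volume_lt_systole_cube (three_quarters_le ha hac) (by linarith [pi_lt_four])⟩

end
end

section
/- Let 0 < a < π/(2√2), let Δ = Δ_sq(a), Λ = 4aℤ × 4aℤ × 2πℤ, and let τ₀ : ℝ³ → ℝ³ be the screw motion τ₀(x,y,z) = (−y, x, z + π/2) (so τ₀² = σ₀ where σ₀(x,y,z) = (−x,−y,z+π)). Then for every v ∈ Λ, every m ∈ ℝ³ and every piecewise C¹ curve γ from m to τ₀(m) + v, one has L_Δ(γ) ≥ π/2; the same bound holds for curves from m to τ₀³(m) + v. (In the singular torus (T, g_c) this says dist(m, τ(m)) ≥ π/2 and dist(m, τ⁻¹(m)) ≥ π/2 for every m, with equality achieved on the rotation axes.) -/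
open Real MeasureTheory Set

noncomputable section

/-- The screw motion `τ₀(x,y,z) = (−y, x, z + π/2)` (a quarter turn, with `τ₀² = σ₀`). -/
def tau0 (p : ℝ × ℝ × ℝ) : ℝ × ℝ × ℝ := (-p.2.1, p.1, p.2.2 + π / 2)

theorem hasDerivAt_mul_of_eq_zero {f g : ℝ → ℝ} {g' t : ℝ} (hf : ContinuousAt f t)
    (hg : HasDerivAt g g' t) (h0 : g t = 0) :
    HasDerivAt (fun s => f s * g s) (f t * g') t := by
  rw [hasDerivAt_iff_tendsto_slope] at hg ⊢
  refine ((hf.tendsto.mono_left nhdsWithin_le_nhds).mul hg).congr fun s => ?_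
  simp only [slope_def_field, h0]
  ring

theorem sq_add_mul_add_mul_le (u₁ u₂ u₃ v₁ v₂ v₃ : ℝ) :
    (u₁ * v₁ + u₂ * v₂ + u₃ * v₃) ^ 2 ≤
      (u₁ ^ 2 + u₂ ^ 2 + u₃ ^ 2) * (v₁ ^ 2 + v₂ ^ 2 + v₃ ^ 2) := by
  nlinarith [sq_nonneg (u₁ * v₂ - u₂ * v₁), sq_nonneg (u₁ * v₃ - u₃ * v₁),
    sq_nonneg (u₂ * v₃ - u₃ * v₂)]

theorem exists_polar {x y : ℝ} (h : 0 < √(x ^ 2 + y ^ 2)) :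
    ∃ u v, u ^ 2 + v ^ 2 = 1 ∧ x = √(x ^ 2 + y ^ 2) * u ∧ y = √(x ^ 2 + y ^ 2) * v := by
  have hsq : √(x ^ 2 + y ^ 2) ^ 2 = x ^ 2 + y ^ 2 := Real.sq_sqrt (by positivity)
  refine ⟨x / √(x ^ 2 + y ^ 2), y / √(x ^ 2 + y ^ 2), ?_, by field_simp, by field_simp⟩
  rw [div_pow, div_pow, ← add_div, hsq, div_self (Real.sqrt_pos.1 h).ne']

/-- In the coordinates `(cos r · e^{iz}, sinc r · (x + iy))` of the round `3`-sphere, with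
`r = √(x² + y²)`, the height function in the direction of the unit vector
`(A e^{iw}, B₁ + i B₂)`. -/
def sphereHeight (A B₁ B₂ w x y z : ℝ) : ℝ :=
  A * (cos √(x ^ 2 + y ^ 2) * cos (z - w)) + sinc √(x ^ 2 + y ^ 2) * (B₁ * x + B₂ * y)

theorem sphereHeight_sq_le_one {A B₁ B₂ : ℝ} (hAB : A ^ 2 + B₁ ^ 2 + B₂ ^ 2 = 1) (w x y z : ℝ) :
    sphereHeight A B₁ B₂ w x y z ^ 2 ≤ 1 := by
  unfold sphereHeight
  set r := √(x ^ 2 + y ^ 2) with hr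
  have hr2 : r ^ 2 = x ^ 2 + y ^ 2 := Real.sq_sqrt (by positivity)
  have hCS := sq_add_mul_add_mul_le A B₁ B₂ (cos r * cos (z - w)) (sinc r * x) (sinc r * y)
  have hle : (cos r * cos (z - w)) ^ 2 ≤ cos r ^ 2 := by
    rw [mul_pow]
    exact mul_le_of_le_one_right (sq_nonneg _) (cos_sq_le_one _)
  have hsum : cos r ^ 2 + (sinc r * x) ^ 2 + (sinc r * y) ^ 2 = 1 := by
    linear_combination sin_sq_add_cos_sq r + (sinc r * r + sin r) * sinc_mul_self r
      - sinc r ^ 2 * hr2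
  rw [hAB, one_mul] at hCS
  refine le_trans (le_of_eq ?_) (hCS.trans (by linarith))
  ring

theorem hasDerivAt_cos_radius_of_eq_zero {x y : ℝ → ℝ} {x' y' t : ℝ}
    (hx : HasDerivAt x x' t) (hy : HasDerivAt y y' t) (hx0 : x t = 0) (hy0 : y t = 0) :
    HasDerivAt (fun s => cos √(x s ^ 2 + y s ^ 2)) 0 t := by
  have hcx := hx.continuousAt
  have hcy := hy.continuousAt
  have hk : ContinuousAt (fun s => sinc (√(x s ^ 2 + y s ^ 2) / 2) ^ 2 / 2) t := by
    have := continuous_sinc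
    fun_prop
  have h1 := hasDerivAt_mul_of_eq_zero (hk.mul hcx) hx hx0
  have h2 := hasDerivAt_mul_of_eq_zero (hk.mul hcy) hy hy0
  refine (((h1.add h2).const_sub 1).congr_deriv ?_).congr_of_eventuallyEq (.of_forall fun s => ?_)
  · simp [hx0, hy0]
  · set r := √(x s ^ 2 + y s ^ 2) with hr
    have hr2 : r ^ 2 = x s ^ 2 + y s ^ 2 := Real.sq_sqrt (by positivity)
    have hs : sinc (r / 2) * r = 2 * sin (r / 2) := by
      rw [← sinc_mul_self]
      ring
    have hc : cos r = 1 - 2 * sin (r / 2) ^ 2 := by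
      have := cos_two_mul (r / 2)
      rw [mul_div_cancel₀ r two_ne_zero] at this
      linarith [sin_sq_add_cos_sq (r / 2)]
    simp only [Pi.add_apply, Pi.mul_apply]
    linear_combination hc + (sinc (r / 2) * r + 2 * sin (r / 2)) / 2 * hs
      - sinc (r / 2) ^ 2 / 2 * hr2

theorem exists_hasDerivAt_sphereHeight {A B₁ B₂ : ℝ} (w : ℝ) (hAB : A ^ 2 + B₁ ^ 2 + B₂ ^ 2 = 1)
    {x y z : ℝ → ℝ} {x' y' z' t : ℝ}
    (hx : HasDerivAt x x' t) (hy : HasDerivAt y y' t) (hz : HasDerivAt z z' t) :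
    ∃ g', HasDerivAt (fun s => sphereHeight A B₁ B₂ w (x s) (y s) (z s)) g' t ∧
      g' ^ 2 ≤ (x' ^ 2 + y' ^ 2 + cos √(x t ^ 2 + y t ^ 2) ^ 2 * z' ^ 2) *
        (1 - sphereHeight A B₁ B₂ w (x t) (y t) (z t) ^ 2) := by
  have hcx := hx.continuousAt
  have hcy := hy.continuousAt
  have hcos := (hz.sub_const w).cos
  have hlin := (hx.const_mul B₁).add (hy.const_mul B₂)
  have hsc := sin_sq_add_cos_sq (z t - w)
  rcases (by positivity : 0 ≤ x t ^ 2 + y t ^ 2).eq_or_lt with h0 | hpos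
  · have hx0 : x t = 0 := by nlinarith [sq_nonneg (x t), sq_nonneg (y t)]
    have hy0 : y t = 0 := by nlinarith [sq_nonneg (x t), sq_nonneg (y t)]
    have hS : ContinuousAt (fun s => sinc √(x s ^ 2 + y s ^ 2)) t := by
      have := continuous_sinc
      fun_prop
    have h1 := ((hasDerivAt_cos_radius_of_eq_zero hx hy hx0 hy0).mul hcos).const_mul A
    have h2 := hasDerivAt_mul_of_eq_zero hS hlin (by simp [hx0, hy0])
    refine ⟨_, h1.add h2, ?_⟩
    have := sq_add_mul_add_mul_le x' y' z' B₁ B₂ (-(A * sin (z t - w)))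
    simp only [sphereHeight, hx0, hy0]
    simp
    refine le_trans (le_of_eq ?_) (this.trans (le_of_eq ?_))
    · ring
    · linear_combination (x' ^ 2 + y' ^ 2 + z' ^ 2) * (hAB + A ^ 2 * hsc)
  · have hr := ((hx.pow 2).add (hy.pow 2)).sqrt hpos.ne'
    set r : ℝ → ℝ := fun s => √(x s ^ 2 + y s ^ 2) with hrdef
    have hrpos : 0 < r t := Real.sqrt_pos.2 hpos
    obtain ⟨u, v, huv, hu, hv⟩ : ∃ u v, u ^ 2 + v ^ 2 = 1 ∧ x t = r t * u ∧ y t = r t * v :=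
      exists_polar hrpos
    have hr' : HasDerivAt r (u * x' + v * y') t := by
      refine hr.congr_deriv ?_
      change _ / (2 * r t) = _
      simp only [hu, hv]
      field_simp
      ring
    have h1 := ((hr'.cos).mul hcos).const_mul A
    have h2 := (hr'.sin).mul (hlin.div hr' hrpos.ne')
    have hg : HasDerivAt (fun s => sphereHeight A B₁ B₂ w (x s) (y s) (z s))
        ((u * x' + v * y') * (cos (r t) * (B₁ * u + B₂ * v) - A * sin (r t) * cos (z t - w))
          + (u * y' - v * x') * (sinc (r t) * (B₂ * u - B₁ * v))
          + cos (r t) * z' * -(A * sin (z t - w))) t := by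
      refine ((h1.add h2).congr_deriv ?_).congr_of_eventuallyEq ?_
      · simp only [Pi.add_apply, Pi.div_apply]
        rw [hu, hv, sinc_of_ne_zero hrpos.ne']
        field_simp
        linear_combination (-(sin (r t) * (B₁ * x' + B₂ * y'))) * huv
      filter_upwards [hr'.continuousAt.eventually_ne hrpos.ne'] with s hs
      change A * (cos (r s) * cos (z s - w)) + sinc (r s) * (B₁ * x s + B₂ * y s) = _
      rw [sinc_of_ne_zero hs]
      simp only [Pi.add_apply, Pi.mul_apply, Pi.div_apply]
      ring
    refine ⟨_, hg, ?_⟩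
    change _ ≤ (x' ^ 2 + y' ^ 2 + cos (r t) ^ 2 * z' ^ 2) *
      (1 - (A * (cos (r t) * cos (z t - w)) + sinc (r t) * (B₁ * x t + B₂ * y t)) ^ 2)
    set R := r t
    set ζ := z t - w
    have hs1 : sinc R ^ 2 ≤ 1 := (sq_le_one_iff_abs_le_one _).2 (abs_sinc_le_one R)
    have hs := sinc_mul_self R
    have hR := sin_sq_add_cos_sq R
    have hCS := sq_add_mul_add_mul_le (u * x' + v * y') (u * y' - v * x') (cos R * z')
      (cos R * (B₁ * u + B₂ * v) - A * sin R * cos ζ) (sinc R * (B₂ * u - B₁ * v))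
      (-(A * sin ζ))
    have hS : (u * x' + v * y') ^ 2 + (u * y' - v * x') ^ 2 + (cos R * z') ^ 2
        = x' ^ 2 + y' ^ 2 + cos R ^ 2 * z' ^ 2 := by
      linear_combination (x' ^ 2 + y' ^ 2) * huv
    rw [hS] at hCS
    have hle : (cos R * (B₁ * u + B₂ * v) - A * sin R * cos ζ) ^ 2
        + (sinc R * (B₂ * u - B₁ * v)) ^ 2 + (-(A * sin ζ)) ^ 2
        ≤ 1 - (A * (cos R * cos ζ) + sinc R * (B₁ * x t + B₂ * y t)) ^ 2 := by
      have hq : sinc R * (B₁ * x t + B₂ * y t) = sin R * (B₁ * u + B₂ * v) := by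
        rw [← hs, hu, hv]; ring
      rw [hq]
      have := mul_le_mul_of_nonneg_right hs1 (sq_nonneg (B₂ * u - B₁ * v))
      have key : 1 - (A * (cos R * cos ζ) + sin R * (B₁ * u + B₂ * v)) ^ 2 =
          (cos R * (B₁ * u + B₂ * v) - A * sin R * cos ζ) ^ 2 + (B₂ * u - B₁ * v) ^ 2
            + (-(A * sin ζ)) ^ 2 := by
        linear_combination (-1) * hAB - A ^ 2 * hsc - (B₁ ^ 2 + B₂ ^ 2) * huv
          - (A ^ 2 * cos ζ ^ 2 + (B₁ * u + B₂ * v) ^ 2) * hR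
      rw [key, mul_pow (sinc R)]
      linarith
    exact hCS.trans (mul_le_mul_of_nonneg_left hle (by positivity))

theorem sub_le_integral_of_abs_deriv_le {f φ : ℝ → ℝ} {a b : ℝ} (hab : a ≤ b) {S : Set ℝ}
    (hS : S.Countable) (hf : ContinuousOn f (Icc a b)) (hφ : IntervalIntegrable φ volume a b)
    (hd : ∀ t ∈ Ioo a b \ S, ∃ f', HasDerivAt f f' t ∧ |f'| ≤ φ t) :
    f b - f a ≤ ∫ t in a..b, φ t := by
  have hae : ∀ᵐ t ∂volume.restrict (Ioc a b), |deriv f t| ≤ φ t := by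
    rw [← restrict_Ioo_eq_restrict_Ioc]
    have hS0 : ∀ᵐ t ∂volume.restrict (Ioo a b), t ∉ S :=
      ae_restrict_of_ae (measure_eq_zero_iff_ae_notMem.1 (hS.measure_zero volume))
    filter_upwards [hS0, ae_restrict_mem measurableSet_Ioo] with t ht htab
    obtain ⟨f', hf', hle⟩ := hd t ⟨htab, ht⟩
    rwa [hf'.deriv]
  have hint : IntervalIntegrable (deriv f) volume a b := by
    rw [intervalIntegrable_iff_integrableOn_Ioc_of_le hab] at hφ ⊢
    exact hφ.mono' (measurable_deriv f).aestronglyMeasurable hae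
  rw [← integral_eq_of_hasDerivAt_off_countable_of_le f (deriv f) hab hS hf
    (fun t ht => (hd t ht).choose_spec.1.differentiableAt.hasDerivAt) hint]
  rw [intervalIntegral.integral_of_le hab, intervalIntegral.integral_of_le hab]
  rw [intervalIntegrable_iff_integrableOn_Ioc_of_le hab] at hφ hint
  exact integral_mono_ae hint hφ (hae.mono fun t ht => (le_abs_self _).trans ht)

theorem exists_mem_Ioo_of_mem_Ioo_of_notMem_range {t : ℕ → ℝ} {x : ℝ} (n : ℕ)
    (h0 : t 0 < x) (hn : x < t n) (hx : x ∉ range t) : ∃ i < n, x ∈ Ioo (t i) (t (i + 1)) := by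
  induction n with
  | zero => exact absurd h0 hn.not_gt
  | succ k ih =>
    rcases lt_trichotomy x (t k) with h | h | h
    · obtain ⟨i, hi, hix⟩ := ih h
      exact ⟨i, by omega, hix⟩
    · exact absurd ⟨k, h.symm⟩ hx
    · exact ⟨k, by omega, h, hn⟩

theorem PC1.exists_countable {f : ℝ → ℝ} (hf : PC1 f) :
    ∃ (S : Set ℝ) (M : ℝ), S.Countable ∧
      ∀ x ∈ Ioo (0 : ℝ) 1 \ S, DifferentiableAt ℝ f x ∧ |deriv f x| ≤ M := by
  obtain ⟨n, t, h0, h1, hlt, -, hC⟩ := hf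
  have hM : ∀ i, ∃ M : ℝ, 0 ≤ M ∧ (i < n → ∀ x ∈ Ioo (t i) (t (i + 1)), |deriv f x| ≤ M) := by
    intro i
    by_cases hi : i < n
    · have hcont := (hC i hi).continuousOn_derivWithin (uniqueDiffOn_Icc (hlt i hi)) le_rfl
      obtain ⟨M, hM⟩ := isCompact_Icc.exists_bound_of_continuousOn hcont
      refine ⟨M, (norm_nonneg _).trans (hM (t i) (left_mem_Icc.2 (hlt i hi).le)),
        fun _ x hx => ?_⟩
      have := hM x (Ioo_subset_Icc_self hx)
      rwa [derivWithin_of_mem_nhds (Icc_mem_nhds hx.1 hx.2)] at this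
    · exact ⟨0, le_rfl, fun h => absurd h hi⟩
  choose M hM0 hM using hM
  refine ⟨range t, ∑ i ∈ Finset.range n, M i, countable_range t, fun x hx => ?_⟩
  obtain ⟨i, hi, hix⟩ := exists_mem_Ioo_of_mem_Ioo_of_notMem_range n (h0 ▸ hx.1.1) (h1 ▸ hx.1.2) hx.2
  exact ⟨((hC i hi).differentiableOn one_ne_zero).differentiableAt (Icc_mem_nhds hix.1 hix.2),
    (hM i hi x hix).trans (Finset.single_le_sum (f := M) (fun j _ => hM0 j) (by simpa using hi))⟩

/-- The integrand of `sLen`. -/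
def sSpeed (Δ : Set (EuclideanSpace ℝ (Fin 2))) (γ₁ γ₂ γ₃ : ℝ → ℝ) (t : ℝ) : ℝ :=
  √((deriv γ₁ t) ^ 2 + (deriv γ₂ t) ^ 2 +
    cos (Metric.infDist (pt2 (γ₁ t) (γ₂ t)) Δ) ^ 2 * (deriv γ₃ t) ^ 2)

theorem intervalIntegrable_sSpeed (Δ : Set (EuclideanSpace ℝ (Fin 2))) {γ₁ γ₂ γ₃ : ℝ → ℝ}
    (h₁ : PC1 γ₁) (h₂ : PC1 γ₂) (h₃ : PC1 γ₃) :
    IntervalIntegrable (sSpeed Δ γ₁ γ₂ γ₃) volume 0 1 := by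
  rw [intervalIntegrable_iff_integrableOn_Ioo_of_le zero_le_one]
  obtain ⟨S₁, M₁, hS₁, hM₁⟩ := h₁.exists_countable
  obtain ⟨S₂, M₂, hS₂, hM₂⟩ := h₂.exists_countable
  obtain ⟨S₃, M₃, hS₃, hM₃⟩ := h₃.exists_countable
  have hae : ∀ {S : Set ℝ}, S.Countable → ∀ᵐ t ∂volume.restrict (Ioo (0 : ℝ) 1), t ∉ S :=
    fun hS => ae_restrict_of_ae (measure_eq_zero_iff_ae_notMem.1 (hS.measure_zero volume))
  refine Integrable.mono' (g := fun _ => √(M₁ ^ 2 + M₂ ^ 2 + 1 * M₃ ^ 2)) (integrable_const _) ?_ ?_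
  · have hc : ContinuousOn (fun t => cos (Metric.infDist (pt2 (γ₁ t) (γ₂ t)) Δ) ^ 2)
        (Ioo 0 1) := by
      have hp : ContinuousOn (fun t => pt2 (γ₁ t) (γ₂ t)) (Ioo 0 1) := by
        refine (PiLp.continuous_toLp 2 _).comp_continuousOn (continuousOn_pi.2 fun i => ?_)
        fin_cases i
        · exact h₁.continuousOn.mono Ioo_subset_Icc_self
        · exact h₂.continuousOn.mono Ioo_subset_Icc_self
      exact ((continuous_cos.comp (Metric.continuous_infDist_pt Δ)).comp_continuousOn hp).pow 2
    have hcm := (hc.aestronglyMeasurable measurableSet_Ioo (μ := volume)).aemeasurable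
    refine (AEMeasurable.sqrt ?_).aestronglyMeasurable
    exact ((((measurable_deriv γ₁).pow_const 2).add
      ((measurable_deriv γ₂).pow_const 2)).aemeasurable).add
        (hcm.mul ((measurable_deriv γ₃).pow_const 2).aemeasurable)
  · filter_upwards [hae hS₁, hae hS₂, hae hS₃, ae_restrict_mem measurableSet_Ioo] with t k₁ k₂ k₃ ht
    rw [norm_of_nonneg (by exact sqrt_nonneg _)]
    refine sqrt_le_sqrt ?_
    have e₁ := sq_le_sq' (abs_le.1 (hM₁ t ⟨ht, k₁⟩).2).1 (abs_le.1 (hM₁ t ⟨ht, k₁⟩).2).2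
    have e₂ := sq_le_sq' (abs_le.1 (hM₂ t ⟨ht, k₂⟩).2).1 (abs_le.1 (hM₂ t ⟨ht, k₂⟩).2).2
    have e₃ := sq_le_sq' (abs_le.1 (hM₃ t ⟨ht, k₃⟩).2).1 (abs_le.1 (hM₃ t ⟨ht, k₃⟩).2).2
    gcongr
    exact cos_sq_le_one _

theorem exists_countable_hasDerivAt {γ₁ γ₂ γ₃ : ℝ → ℝ} (h₁ : PC1 γ₁) (h₂ : PC1 γ₂)
    (h₃ : PC1 γ₃) : ∃ S : Set ℝ, S.Countable ∧ ∀ t ∈ Ioo (0 : ℝ) 1 \ S,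
      HasDerivAt γ₁ (deriv γ₁ t) t ∧ HasDerivAt γ₂ (deriv γ₂ t) t ∧
        HasDerivAt γ₃ (deriv γ₃ t) t := by
  obtain ⟨S₁, M₁, hS₁, hM₁⟩ := h₁.exists_countable
  obtain ⟨S₂, M₂, hS₂, hM₂⟩ := h₂.exists_countable
  obtain ⟨S₃, M₃, hS₃, hM₃⟩ := h₃.exists_countable
  refine ⟨S₁ ∪ S₂ ∪ S₃, (hS₁.union hS₂).union hS₃, fun t ht => ?_⟩
  simp only [mem_sdiff, mem_union, not_or] at ht
  exact ⟨(hM₁ t ⟨ht.1, ht.2.1.1⟩).1.hasDerivAt, (hM₂ t ⟨ht.1, ht.2.1.2⟩).1.hasDerivAt,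
    (hM₃ t ⟨ht.1, ht.2.2⟩).1.hasDerivAt⟩

/-- The length of a curve bounds the displacement of its planar projection in any direction. -/
theorem displacement_le_integral_sSpeed (Δ : Set (EuclideanSpace ℝ (Fin 2))) {γ₁ γ₂ γ₃ : ℝ → ℝ}
    (h₁ : PC1 γ₁) (h₂ : PC1 γ₂) (h₃ : PC1 γ₃) {s t : ℝ} (hs : 0 ≤ s) (hst : s ≤ t) (ht : t ≤ 1)
    {α β : ℝ} (hαβ : α ^ 2 + β ^ 2 = 1) :
    α * (γ₁ t - γ₁ s) + β * (γ₂ t - γ₂ s) ≤ ∫ u in s..t, sSpeed Δ γ₁ γ₂ γ₃ u := by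
  obtain ⟨S, hS, hd⟩ := exists_countable_hasDerivAt h₁ h₂ h₃
  have hsub : Icc s t ⊆ Icc 0 1 := Icc_subset_Icc hs ht
  have hint : IntervalIntegrable (sSpeed Δ γ₁ γ₂ γ₃) volume s t := by
    refine (intervalIntegrable_sSpeed Δ h₁ h₂ h₃).mono_set ?_
    rwa [uIcc_of_le hst, uIcc_of_le zero_le_one]
  have := sub_le_integral_of_abs_deriv_le (f := fun u => α * γ₁ u + β * γ₂ u) hst hS
    (((h₁.continuousOn.mono hsub).const_mul α).add ((h₂.continuousOn.mono hsub).const_mul β)) hint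
    (fun u hu => ?_)
  · linarith
  · obtain ⟨d₁, d₂, -⟩ := hd u ⟨Ioo_subset_Ioo hs ht hu.1, hu.2⟩
    refine ⟨_, (d₁.const_mul α).add (d₂.const_mul β), abs_le_sqrt ?_⟩
    have : 0 ≤ cos (Metric.infDist (pt2 (γ₁ u) (γ₂ u)) Δ) ^ 2 * (deriv γ₃ u) ^ 2 := by positivity
    have e : (α * deriv γ₁ u + β * deriv γ₂ u) ^ 2 + (α * deriv γ₂ u - β * deriv γ₁ u) ^ 2
        = deriv γ₁ u ^ 2 + deriv γ₂ u ^ 2 := by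
      linear_combination (deriv γ₁ u ^ 2 + deriv γ₂ u ^ 2) * hαβ
    nlinarith [sq_nonneg (α * deriv γ₂ u - β * deriv γ₁ u)]

/-- A curve whose planar endpoints differ by a quarter turn about `(c₁, c₂)` (counterclockwise for
`ε = 1`, clockwise for `ε = -1`) and which leaves the disc of radius `ρ` about `(c₁, c₂)` has length
at least `ρ`. -/
theorem radius_le_sLen_of_quarter_turn (Δ : Set (EuclideanSpace ℝ (Fin 2))) {γ₁ γ₂ γ₃ : ℝ → ℝ}
    (h₁ : PC1 γ₁) (h₂ : PC1 γ₂) (h₃ : PC1 γ₃) {c₁ c₂ ε : ℝ} (hε : ε ^ 2 = 1)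
    (e₁ : γ₁ 1 - c₁ = -ε * (γ₂ 0 - c₂)) (e₂ : γ₂ 1 - c₂ = ε * (γ₁ 0 - c₁))
    {t : ℝ} (ht : t ∈ Icc (0 : ℝ) 1) {ρ : ℝ} (hρ : 0 < ρ)
    (hle : ρ ≤ √((γ₁ t - c₁) ^ 2 + (γ₂ t - c₂) ^ 2)) : ρ ≤ sLen Δ γ₁ γ₂ γ₃ := by
  set R := √((γ₁ t - c₁) ^ 2 + (γ₂ t - c₂) ^ 2) with hR
  have hRpos : 0 < R := hρ.trans_le hle
  obtain ⟨α, β, hαβ, hα, hβ⟩ : ∃ α β, α ^ 2 + β ^ 2 = 1 ∧ γ₁ t - c₁ = R * α ∧ γ₂ t - c₂ = R * β :=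
    exists_polar hRpos
  have hint := intervalIntegrable_sSpeed Δ h₁ h₂ h₃
  have hadd : (∫ u in (0 : ℝ)..t, sSpeed Δ γ₁ γ₂ γ₃ u) + ∫ u in t..1, sSpeed Δ γ₁ γ₂ γ₃ u
      = sLen Δ γ₁ γ₂ γ₃ := by
    refine intervalIntegral.integral_add_adjacent_intervals (hint.mono_set ?_) (hint.mono_set ?_)
    · rw [uIcc_of_le ht.1, uIcc_of_le zero_le_one]; exact Icc_subset_Icc le_rfl ht.2
    · rw [uIcc_of_le ht.2, uIcc_of_le zero_le_one]; exact Icc_subset_Icc ht.1 le_rfl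
  have b₁ := displacement_le_integral_sSpeed Δ h₁ h₂ h₃ le_rfl ht.1 ht.2 hαβ
  have b₂ := displacement_le_integral_sSpeed Δ h₁ h₂ h₃ le_rfl ht.1 ht.2
    (α := -ε * β) (β := ε * α) (by linear_combination hαβ + (α ^ 2 + β ^ 2) * hε)
  have b₃ := displacement_le_integral_sSpeed Δ h₁ h₂ h₃ ht.1 ht.2 le_rfl
    (α := -α) (β := -β) (by linear_combination hαβ)
  have b₄ := displacement_le_integral_sSpeed Δ h₁ h₂ h₃ ht.1 ht.2 le_rfl
    (α := -ε * β) (β := ε * α) (by linear_combination hαβ + (α ^ 2 + β ^ 2) * hε)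
  have hsum : (α * (γ₁ t - γ₁ 0) + β * (γ₂ t - γ₂ 0))
      + (-ε * β * (γ₁ t - γ₁ 0) + ε * α * (γ₂ t - γ₂ 0))
      + (-α * (γ₁ 1 - γ₁ t) + -β * (γ₂ 1 - γ₂ t))
      + (-ε * β * (γ₁ 1 - γ₁ t) + ε * α * (γ₂ 1 - γ₂ t)) = 2 * R := by
    rw [sub_eq_iff_eq_add.1 hα, sub_eq_iff_eq_add.1 hβ, sub_eq_iff_eq_add.1 e₁,
      sub_eq_iff_eq_add.1 e₂]
    linear_combination 2 * R * hαβ + (α * (γ₁ 0 - c₁) + β * (γ₂ 0 - c₂)) * hε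
  linarith

/-- A curve that stays in the disc of radius `π / 2` about the point `(c₁, c₂)` of `Δ`, and whose
endpoints correspond to orthogonal points of the round `3`-sphere, has length at least `π / 2`. -/
theorem pi_div_two_le_sLen_of_quarter_screw {Δ : Set (EuclideanSpace ℝ (Fin 2))}
    {γ₁ γ₂ γ₃ : ℝ → ℝ} (h₁ : PC1 γ₁) (h₂ : PC1 γ₂) (h₃ : PC1 γ₃) {c₁ c₂ ε : ℝ}
    (hc : pt2 c₁ c₂ ∈ Δ) (hε : ε ^ 2 = 1)
    (e₁ : γ₁ 1 - c₁ = -ε * (γ₂ 0 - c₂)) (e₂ : γ₂ 1 - c₂ = ε * (γ₁ 0 - c₁))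
    (e₃ : cos (γ₃ 0 - γ₃ 1) = 0)
    (hlt : ∀ t ∈ Icc (0 : ℝ) 1, √((γ₁ t - c₁) ^ 2 + (γ₂ t - c₂) ^ 2) < π / 2) :
    π / 2 ≤ sLen Δ γ₁ γ₂ γ₃ := by
  obtain ⟨S, hS, hd⟩ := exists_countable_hasDerivAt h₁ h₂ h₃
  have hint := intervalIntegrable_sSpeed Δ h₁ h₂ h₃
  set x : ℝ → ℝ := fun t => γ₁ t - c₁ with hx
  set y : ℝ → ℝ := fun t => γ₂ t - c₂ with hy
  set R := √(x 1 ^ 2 + y 1 ^ 2) with hR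
  have hR2 : R ^ 2 = x 1 ^ 2 + y 1 ^ 2 := Real.sq_sqrt (by positivity)
  have hsR := sinc_mul_self R
  have hAB : cos R ^ 2 + (sinc R * x 1) ^ 2 + (sinc R * y 1) ^ 2 = 1 := by
    linear_combination sin_sq_add_cos_sq R + (sinc R * R + sin R) * hsR - sinc R ^ 2 * hR2
  set g : ℝ → ℝ := fun t =>
    sphereHeight (cos R) (sinc R * x 1) (sinc R * y 1) (γ₃ 1) (x t) (y t) (γ₃ t) with hg
  have hg0 : g 0 = 0 := by
    have hr0 : √(x 0 ^ 2 + y 0 ^ 2) = R := by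
      rw [hR]
      congr 1
      have e₁' : x 1 = -ε * y 0 := e₁
      have e₂' : y 1 = ε * x 0 := e₂
      rw [e₁', e₂']
      linear_combination (-(x 0 ^ 2 + y 0 ^ 2)) * hε
    have e₁' : x 1 = -ε * y 0 := e₁
    have e₂' : y 1 = ε * x 0 := e₂
    simp only [hg, sphereHeight, hr0, e₃, e₁', e₂']
    ring
  have hg1 : g 1 = 1 := by
    simp only [hg, sphereHeight, sub_self, cos_zero, ← hR]
    linear_combination hAB
  have hgc : ContinuousOn g (Icc 0 1) := by
    have c₁ := h₁.continuousOn
    have c₂ := h₂.continuousOn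
    have c₃ := h₃.continuousOn
    have := continuous_sinc
    have hxc : ContinuousOn x (Icc 0 1) := c₁.sub continuousOn_const
    have hyc : ContinuousOn y (Icc 0 1) := c₂.sub continuousOn_const
    simp only [hg, sphereHeight]
    fun_prop
  have harcsin : ∀ k ∈ Ioo (0 : ℝ) 1, arcsin k ≤ sLen Δ γ₁ γ₂ γ₃ := by
    intro k hk
    have := sub_le_integral_of_abs_deriv_le (f := fun t => arcsin (k * g t)) zero_le_one hS
      (continuous_arcsin.comp_continuousOn (hgc.const_mul k)) hint (fun t ht => ?_)
    · simp only [hg0, hg1, mul_one, mul_zero, arcsin_zero, sub_zero] at this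
      exact this
    · obtain ⟨d₁, d₂, d₃⟩ := hd t ht
      obtain ⟨g', hg', hle⟩ := exists_hasDerivAt_sphereHeight (γ₃ 1) hAB (d₁.sub_const c₁)
        (d₂.sub_const c₂) d₃
      change g' ^ 2 ≤ (_ + cos √(x t ^ 2 + y t ^ 2) ^ 2 * _) * (1 - g t ^ 2) at hle
      have htI : t ∈ Icc (0 : ℝ) 1 := Ioo_subset_Icc_self ht.1
      have hdist : Metric.infDist (pt2 (γ₁ t) (γ₂ t)) Δ ≤ √(x t ^ 2 + y t ^ 2) := by
        refine (Metric.infDist_le_dist_of_mem hc).trans_eq ?_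
        simp [pt2, EuclideanSpace.dist_eq, Real.dist_eq, hx, hy]
      have hcos := cos_le_cos_of_nonneg_of_le_pi Metric.infDist_nonneg
        ((hlt t htI).le.trans (by linarith [pi_pos])) hdist
      have hcos0 : 0 ≤ cos √(x t ^ 2 + y t ^ 2) :=
        cos_nonneg_of_mem_Icc ⟨by linarith [sqrt_nonneg (x t ^ 2 + y t ^ 2), pi_pos],
          (hlt t htI).le⟩
      have hg2 : g t ^ 2 ≤ 1 := sphereHeight_sq_le_one hAB _ _ _ _
      have hk2 : k ^ 2 < 1 := by nlinarith [hk.1, hk.2]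
      have hkg_le : (k * g t) ^ 2 ≤ g t ^ 2 := by
        rw [mul_pow]
        exact mul_le_of_le_one_left (sq_nonneg _) hk2.le
      have hkg : (k * g t) ^ 2 < 1 := by
        rw [mul_pow]
        exact (mul_le_of_le_one_right (sq_nonneg k) hg2).trans_lt hk2
      have hkg' := abs_lt.1 ((sq_lt_one_iff_abs_lt_one _).1 hkg)
      refine ⟨_, HasDerivAt.comp (h := fun s => k * g s) t (hasDerivAt_arcsin hkg'.1.ne' hkg'.2.ne)
        (hg'.const_mul k), abs_le_sqrt ?_⟩
      have hpos : 0 < 1 - (k * g t) ^ 2 := by linarith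
      rw [mul_pow, div_pow, one_pow, Real.sq_sqrt hpos.le, one_div_mul_eq_div, div_le_iff₀ hpos]
      calc
        (k * g') ^ 2 ≤ g' ^ 2 := by
          rw [mul_pow]
          exact mul_le_of_le_one_left (sq_nonneg _) hk2.le
        _ ≤ _ := hle
        _ ≤ _ := by
          refine mul_le_mul ?_ (sub_le_sub_left hkg_le 1) (by linarith) (by positivity)
          gcongr
  have hlim : Filter.Tendsto arcsin (nhdsWithin 1 (Iio 1)) (nhds (π / 2)) :=
    arcsin_one ▸ (continuous_arcsin.tendsto 1).mono_left nhdsWithin_le_nhds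
  exact le_of_tendsto hlim (Filter.mem_of_superset (Ioo_mem_nhdsLT zero_lt_one) harcsin)

/-- for `0 < a < π/(2√2)`, `Δ = Δ_sq(a)`, `Λ = 4aℤ × 4aℤ × 2πℤ`, every
piecewise `C¹` curve from `m` to `τ₀(m) + v` or to `τ₀³(m) + v` (`v ∈ Λ`) has
`L_Δ`-length at least `π/2`; i.e. in the singular torus `(T, g_c)`,
`dist(m, τ(m)) ≥ π/2` and `dist(m, τ⁻¹(m)) ≥ π/2` for every `m`. -/
theorem distance_to_tau_orbit_square (a : ℝ) (ha : 0 < a)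
    (ha' : a < π / (2 * Real.sqrt 2))
    (v : ℝ × ℝ × ℝ) (hv : v ∈ Λsq3 a)
    (γ₁ γ₂ γ₃ : ℝ → ℝ) (h₁ : PC1 γ₁) (h₂ : PC1 γ₂) (h₃ : PC1 γ₃)
    (hend : (γ₁ 1, γ₂ 1, γ₃ 1) = tau0 (γ₁ 0, γ₂ 0, γ₃ 0) + v ∨
      (γ₁ 1, γ₂ 1, γ₃ 1) = tau0 (tau0 (tau0 (γ₁ 0, γ₂ 0, γ₃ 0))) + v) :
    π / 2 ≤ sLen (ΔsqE a) γ₁ γ₂ γ₃ := by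
  obtain ⟨k₁, k₂, k₃, rfl⟩ := hv
  suffices H : ∃ c₁ c₂ ε : ℝ, pt2 c₁ c₂ ∈ ΔsqE a ∧ ε ^ 2 = 1 ∧ γ₁ 1 - c₁ = -ε * (γ₂ 0 - c₂) ∧
      γ₂ 1 - c₂ = ε * (γ₁ 0 - c₁) ∧ cos (γ₃ 0 - γ₃ 1) = 0 by
    obtain ⟨c₁, c₂, ε, hc, hε, e₁, e₂, e₃⟩ := H
    by_cases hlt : ∀ t ∈ Icc (0 : ℝ) 1, √((γ₁ t - c₁) ^ 2 + (γ₂ t - c₂) ^ 2) < π / 2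
    · exact pi_div_two_le_sLen_of_quarter_screw h₁ h₂ h₃ hc hε e₁ e₂ e₃ hlt
    · push Not at hlt
      obtain ⟨t, ht, hle⟩ := hlt
      exact radius_le_sLen_of_quarter_turn _ h₁ h₂ h₃ hε e₁ e₂ ht pi_div_two_pos hle
  simp only [tau0, Prod.mk_add_mk, Prod.mk.injEq] at hend
  rcases hend with ⟨e₁, e₂, e₃⟩ | ⟨e₁, e₂, e₃⟩
  · refine ⟨2 * a * (k₁ - k₂ : ℤ), 2 * a * (k₁ + k₂ : ℤ), 1, ⟨_, _, rfl⟩, by norm_num, ?_, ?_, ?_⟩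
    · push_cast
      linear_combination e₁
    · push_cast
      linear_combination e₂
    · rw [cos_eq_zero_iff]
      exact ⟨-(2 * k₃) - 1, by push_cast; linear_combination -e₃⟩
  · refine ⟨2 * a * (k₁ + k₂ : ℤ), 2 * a * (k₂ - k₁ : ℤ), -1, ⟨_, _, rfl⟩, by norm_num, ?_, ?_, ?_⟩
    · push_cast
      linear_combination e₁
    · push_cast
      linear_combination e₂
    · rw [cos_eq_zero_iff]
      exact ⟨-(2 * k₃) - 2, by push_cast; linear_combination -e₃⟩

end
end
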